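/- arXiv:0802.1111 — 5 statements merged into one kernel-verified Lean document; each statement's English description precedes it below -/
import Mathlib

section
/- Let Ω be a nonempty bounded open subset of ℝⁿ, let b : Ω → ℝ be twice continuously differentiable with bounded first and second derivatives, and set q(x,p) := −(p/2)Δb(x) + (p²/4)|∇b(x)|². Then for all real p₁ > p₂ ≥ 0, inf_{x∈Ω} q(x, p₁+p₂) ≤ ((p₁+p₂)/(p₁−p₂)) (λ₁(p₁) − λ₁(p₂)) ≤ sup_{x∈Ω} q(x, p₁+p₂), where λ₁(p) := λ₁(q(·,p)). -/
open MeasureTheory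

/-- The Rayleigh quotient `J_q(φ)` on the domain `Ω`. -/
noncomputable def rayleigh {n : ℕ} (Ω : Set (EuclideanSpace ℝ (Fin n)))
    (q : EuclideanSpace ℝ (Fin n) → ℝ) (φ : EuclideanSpace ℝ (Fin n) → ℝ) : ℝ :=
  (∫ x in Ω, (‖fderiv ℝ φ x‖ ^ 2 + q x * φ x ^ 2)) / (∫ x in Ω, φ x ^ 2)

/-- The variational principal eigenvalue `λ₁(q)`: the infimum of the Rayleigh quotient
over nonzero smooth compactly supported test functions supported in `Ω`. -/
noncomputable def lam1 {n : ℕ} (Ω : Set (EuclideanSpace ℝ (Fin n)))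
    (q : EuclideanSpace ℝ (Fin n) → ℝ) : ℝ :=
  sInf (rayleigh Ω q ''
    {φ | ContDiff ℝ (⊤ : ℕ∞) φ ∧ HasCompactSupport φ ∧ tsupport φ ⊆ Ω ∧ φ ≠ 0})

/-- The Laplacian `Δb(x) = ∑ i, ∂²b/∂xᵢ²(x)`. -/
noncomputable def lap {n : ℕ} (b : EuclideanSpace ℝ (Fin n) → ℝ)
    (x : EuclideanSpace ℝ (Fin n)) : ℝ :=
  ∑ i : Fin n, fderiv ℝ (fun y => fderiv ℝ b y (EuclideanSpace.single i 1)) x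
      (EuclideanSpace.single i 1)

/-- `q(x,p) = -(p/2) Δb(x) + (p²/4) |∇b(x)|²`. -/
noncomputable def qfun {n : ℕ} (b : EuclideanSpace ℝ (Fin n) → ℝ) (p : ℝ)
    (x : EuclideanSpace ℝ (Fin n)) : ℝ :=
  -(p / 2) * lap b x + (p ^ 2 / 4) * ‖fderiv ℝ b x‖ ^ 2


theorem aux_integrable {n : ℕ} {Ω : Set (EuclideanSpace ℝ (Fin n))}
    {q φ : EuclideanSpace ℝ (Fin n) → ℝ} (hq : ContinuousOn q Ω)
    (h1 : Continuous φ) (h2 : HasCompactSupport φ) (h3 : tsupport φ ⊆ Ω) :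
    IntegrableOn (fun x => q x * φ x ^ 2) Ω := by
  have h : IntegrableOn (fun x => q x * φ x ^ 2) (tsupport φ) :=
    ((hq.mono h3).mul (h1.pow 2).continuousOn).integrableOn_compact h2
  rw [integrableOn_iff_integrable_of_support_subset] at h
  · exact h.integrableOn
  · intro x hx
    apply subset_tsupport
    intro h0
    apply hx
    simp [h0]

theorem aux_grad {n : ℕ} {Ω : Set (EuclideanSpace ℝ (Fin n))}
    {φ : EuclideanSpace ℝ (Fin n) → ℝ}
    (h1 : ContDiff ℝ (⊤ : ℕ∞) φ) (h2 : HasCompactSupport φ) :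
    IntegrableOn (fun x => ‖fderiv ℝ φ x‖ ^ 2) Ω := by
  have hc : Continuous (fun x => ‖fderiv ℝ φ x‖ ^ 2) :=
    ((h1.continuous_fderiv (by simp)).norm.pow 2)
  have hs : HasCompactSupport (fun x => ‖fderiv ℝ φ x‖ ^ 2) :=
    (h2.fderiv ℝ).comp_left (g := fun L => ‖L‖ ^ 2) (by simp)
  exact (hc.integrable_of_hasCompactSupport hs).integrableOn

theorem aux_pos {n : ℕ} {Ω : Set (EuclideanSpace ℝ (Fin n))}
    {φ : EuclideanSpace ℝ (Fin n) → ℝ}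
    (h1 : Continuous φ) (h2 : HasCompactSupport φ) (h3 : tsupport φ ⊆ Ω) (h4 : φ ≠ 0) :
    0 < ∫ x in Ω, φ x ^ 2 := by
  rw [setIntegral_eq_integral_of_forall_compl_eq_zero]
  · obtain ⟨x, hx⟩ := Function.ne_iff.mp h4
    exact (h1.pow 2).integral_pos_of_hasCompactSupport_nonneg_nonzero
      (h2.comp_left (g := fun t : ℝ => t ^ 2) (by simp)) (fun x => sq_nonneg _)
      (x := x) (pow_ne_zero 2 hx)
  · intro x hx
    have : φ x = 0 := by
      by_contra h
      exact hx (h3 (subset_tsupport φ h))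
    simp [this]

theorem aux_rayleigh {n : ℕ} {Ω : Set (EuclideanSpace ℝ (Fin n))} (hΩo : IsOpen Ω)
    {q₁ q₂ φ : EuclideanSpace ℝ (Fin n) → ℝ} {c : ℝ} (hq1 : ContinuousOn q₁ Ω)
    (hq2 : ContinuousOn q₂ Ω) (hle : ∀ x ∈ Ω, q₁ x ≤ q₂ x + c)
    (h1 : ContDiff ℝ (⊤ : ℕ∞) φ) (h2 : HasCompactSupport φ) (h3 : tsupport φ ⊆ Ω) (h4 : φ ≠ 0) :
    rayleigh Ω q₁ φ ≤ rayleigh Ω q₂ φ + c := by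
  have hp := aux_pos h1.continuous h2 h3 h4
  have hg := aux_grad (Ω := Ω) h1 h2
  have i1 := aux_integrable hq1 h1.continuous h2 h3
  have i2 := aux_integrable hq2 h1.continuous h2 h3
  have i3 : IntegrableOn (fun x => c * φ x ^ 2) Ω :=
    aux_integrable continuousOn_const h1.continuous h2 h3
  have i4 : IntegrableOn (fun x => ‖fderiv ℝ φ x‖ ^ 2 + q₂ x * φ x ^ 2) Ω := hg.add i2
  unfold rayleigh
  rw [div_add' _ _ _ hp.ne', ← integral_const_mul, ← integral_add i4 i3]
  apply div_le_div_of_nonneg_right _ hp.le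
  apply setIntegral_mono_on (hg.add i1) (i4.add i3) hΩo.measurableSet
  intro x hx
  have := mul_le_mul_of_nonneg_right (hle x hx) (sq_nonneg (φ x))
  simp only [Pi.add_apply]
  linarith

theorem aux_lam {n : ℕ} {Ω : Set (EuclideanSpace ℝ (Fin n))} (hΩo : IsOpen Ω)
    (hne : Ω.Nonempty)
    {q₁ q₂ : EuclideanSpace ℝ (Fin n) → ℝ} {c m : ℝ} (hq1 : ContinuousOn q₁ Ω)
    (hq2 : ContinuousOn q₂ Ω) (hle : ∀ x ∈ Ω, q₁ x ≤ q₂ x + c)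
    (hm : ∀ x ∈ Ω, -m ≤ q₁ x) :
    lam1 Ω q₁ ≤ lam1 Ω q₂ + c := by
  rw [← sub_le_iff_le_add]
  unfold lam1
  apply le_csInf
  · obtain ⟨x, hx⟩ := hne
    obtain ⟨f, hf1, hf2, hf3, -, hf5⟩ := exists_contDiff_tsupport_subset (n := (⊤ : ℕ∞)) (hΩo.mem_nhds hx)
    refine Set.Nonempty.image _ ⟨f, hf3, hf2, hf1, ?_⟩
    intro h
    simp [h] at hf5
  · rintro _ ⟨φ, ⟨h1, h2, h3, h4⟩, rfl⟩
    rw [sub_le_iff_le_add]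
    refine le_trans (csInf_le ?_ ⟨φ, ⟨h1, h2, h3, h4⟩, rfl⟩)
      (aux_rayleigh hΩo hq1 hq2 hle h1 h2 h3 h4)
    refine ⟨-m, ?_⟩
    rintro _ ⟨ψ, ⟨h1, h2, h3, h4⟩, rfl⟩
    have := aux_rayleigh (q₁ := fun _ => 0) (c := m) hΩo continuousOn_const hq1
      (fun x hx => by linarith [hm x hx]) h1 h2 h3 h4
    have h0 : 0 ≤ rayleigh Ω (fun _ => 0) ψ := by
      unfold rayleigh
      apply div_nonneg <;> apply integral_nonneg <;> intro x <;> simp <;> positivity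
    linarith

theorem aux_lap {n : ℕ} {Ω : Set (EuclideanSpace ℝ (Fin n))} (hΩo : IsOpen Ω)
    {b : EuclideanSpace ℝ (Fin n) → ℝ} (hb : ContDiffOn ℝ 2 b Ω)
    {x : EuclideanSpace ℝ (Fin n)} (hx : x ∈ Ω) :
    lap b x = ∑ i : Fin n, fderiv ℝ (fderiv ℝ b) x (EuclideanSpace.single i 1)
      (EuclideanSpace.single i 1) := by
  have hd : DifferentiableAt ℝ (fderiv ℝ b) x :=
    ((hb.fderiv_of_isOpen hΩo (m := 1) (by norm_num)).differentiableOn (by simp)).differentiableAt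
      (hΩo.mem_nhds hx)
  unfold lap
  refine Finset.sum_congr rfl fun i _ => ?_
  rw [fderiv_clm_apply hd (differentiableAt_const _)]
  simp

theorem aux_cont {n : ℕ} {Ω : Set (EuclideanSpace ℝ (Fin n))} (hΩo : IsOpen Ω)
    {b : EuclideanSpace ℝ (Fin n) → ℝ} (hb : ContDiffOn ℝ 2 b Ω) (p : ℝ) :
    ContinuousOn (qfun b p) Ω := by
  have hd := hb.fderiv_of_isOpen hΩo (m := 1) (by norm_num)
  have hdd : ContinuousOn (fderiv ℝ (fderiv ℝ b)) Ω :=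
    hd.continuousOn_fderiv_of_isOpen hΩo (by simp)
  have hl : ContinuousOn (lap b) Ω := by
    refine ContinuousOn.congr ?_ (fun x hx => aux_lap hΩo hb hx)
    refine continuousOn_finsetSum _ fun i _ => ?_
    exact (hdd.clm_apply continuousOn_const).clm_apply continuousOn_const
  exact (continuousOn_const.mul hl).add (continuousOn_const.mul (hd.continuousOn.norm.pow 2))

theorem aux_bdd {n : ℕ} {Ω : Set (EuclideanSpace ℝ (Fin n))} (hΩo : IsOpen Ω)
    {b : EuclideanSpace ℝ (Fin n) → ℝ} (hb : ContDiffOn ℝ 2 b Ω)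
    (hb1 : ∃ M, ∀ x ∈ Ω, ‖fderiv ℝ b x‖ ≤ M)
    (hb2 : ∃ M, ∀ x ∈ Ω, ‖fderiv ℝ (fderiv ℝ b) x‖ ≤ M) (p : ℝ) :
    ∃ m, ∀ x ∈ Ω, |qfun b p x| ≤ m := by
  obtain ⟨M, hM⟩ := hb1
  obtain ⟨N, hN⟩ := hb2
  refine ⟨|p / 2| * (n * N) + (p ^ 2 / 4) * M ^ 2, fun x hx => ?_⟩
  have hl : |lap b x| ≤ n * N := by
    rw [aux_lap hΩo hb hx]
    refine (Finset.abs_sum_le_sum_abs _ _).trans ?_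
    refine (Finset.sum_le_sum (g := fun _ => N) fun i _ => ?_).trans (by simp)
    have := (fderiv ℝ (fderiv ℝ b) x).le_opNorm₂ (EuclideanSpace.single i 1)
      (EuclideanSpace.single i 1)
    simp at this
    exact this.trans (hN x hx)
  unfold qfun
  refine (abs_add_le _ _).trans (add_le_add ?_ ?_)
  · rw [abs_mul, abs_neg]
    gcongr
  · rw [abs_of_nonneg (by positivity)]
    gcongr
    exact hM x hx

theorem eigenvalue_difference_estimate {n : ℕ} (hn : 1 ≤ n)
    (Ω : Set (EuclideanSpace ℝ (Fin n)))
    (hΩne : Ω.Nonempty) (hΩo : IsOpen Ω) (hΩbd : Bornology.IsBounded Ω)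
    (b : EuclideanSpace ℝ (Fin n) → ℝ) (hb : ContDiffOn ℝ 2 b Ω)
    (hb1 : ∃ M, ∀ x ∈ Ω, ‖fderiv ℝ b x‖ ≤ M)
    (hb2 : ∃ M, ∀ x ∈ Ω, ‖fderiv ℝ (fderiv ℝ b) x‖ ≤ M)
    (p₁ p₂ : ℝ) (h12 : p₂ < p₁) (h2 : 0 ≤ p₂) :
    sInf (qfun b (p₁ + p₂) '' Ω) ≤
      ((p₁ + p₂) / (p₁ - p₂)) * (lam1 Ω (qfun b p₁) - lam1 Ω (qfun b p₂)) ∧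
    ((p₁ + p₂) / (p₁ - p₂)) * (lam1 Ω (qfun b p₁) - lam1 Ω (qfun b p₂)) ≤
      sSup (qfun b (p₁ + p₂) '' Ω) := by
  have hP : 0 < p₁ + p₂ := by linarith
  have hd : 0 < p₁ - p₂ := by linarith
  have key : ∀ x, qfun b p₁ x = qfun b p₂ x + (p₁ - p₂) / (p₁ + p₂) * qfun b (p₁ + p₂) x := by
    intro x
    unfold qfun
    field_simp
    ring
  have hc := fun p => aux_cont hΩo hb p
  have hB := fun p => aux_bdd hΩo hb hb1 hb2 p
  obtain ⟨m, hm⟩ := hB (p₁ + p₂)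
  obtain ⟨m1, hm1⟩ := hB p₁
  obtain ⟨m2, hm2⟩ := hB p₂
  have hr : 0 < (p₁ - p₂) / (p₁ + p₂) := div_pos hd hP
  have hinv : (p₁ + p₂) / (p₁ - p₂) = ((p₁ - p₂) / (p₁ + p₂))⁻¹ := (inv_div _ _).symm
  rw [hinv]
  have up := aux_lam (c := (p₁ - p₂) / (p₁ + p₂) * sSup (qfun b (p₁ + p₂) '' Ω)) hΩo hΩne
    (hc p₁) (hc p₂) (fun x hx => by
      rw [key x]
      gcongr
      refine le_csSup ⟨m, ?_⟩ ⟨x, hx, rfl⟩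
      rintro _ ⟨y, hy, rfl⟩
      exact (abs_le.mp (hm y hy)).2) (fun x hx => (abs_le.mp (hm1 x hx)).1)
  have lo := aux_lam (c := -((p₁ - p₂) / (p₁ + p₂) * sInf (qfun b (p₁ + p₂) '' Ω))) hΩo hΩne
    (hc p₂) (hc p₁) (fun x hx => by
      rw [key x]
      have h : sInf (qfun b (p₁ + p₂) '' Ω) ≤ qfun b (p₁ + p₂) x := by
        refine csInf_le ⟨-m, ?_⟩ ⟨x, hx, rfl⟩
        rintro _ ⟨y, hy, rfl⟩
        exact (abs_le.mp (hm y hy)).1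
      have := mul_le_mul_of_nonneg_left h hr.le
      linarith) (fun x hx => (abs_le.mp (hm2 x hx)).1)
  constructor
  · rw [le_inv_mul_iff₀ hr]
    linarith
  · rw [inv_mul_le_iff₀ hr]
    linarith
end

section
/- Let Ω be a nonempty bounded open subset of ℝⁿ and b : ℝⁿ → ℝ Lipschitz continuous. Let Ω₁, …, Ω_m be potential wells with pairwise disjoint closures, each of depth at least ω₀ > 0 (a potential well is a nonempty open Ω_j ⊆ Ω with min_{cl(Ω_j)} b < min_{∂Ω_j} b, its depth being the difference). Then for every ω ∈ (0, ω₀) there exist a constant C > 0 and nonzero Lipschitz functions û₁, …, û_m : ℝⁿ → ℝ, with û_j supported in cl(Ω_j) (hence with pairwise disjoint supports, and in particular linearly independent), such that for every p ≥ 0 and every (c₁,…,c_m) ∈ ℝᵐ \ {0}, the weighted Rayleigh quotient satisfies I_{pb}(c₁û₁ + ⋯ + c_mû_m) ≤ C e^{−ωp}. -/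
open MeasureTheory

/-- The weighted Rayleigh quotient `I_{pb}(u)` on `Ω`. -/
noncomputable def Ipb {n : ℕ} (Ω : Set (EuclideanSpace ℝ (Fin n)))
    (b : EuclideanSpace ℝ (Fin n) → ℝ) (p : ℝ)
    (u : EuclideanSpace ℝ (Fin n) → ℝ) : ℝ :=
  (∫ x in Ω, Real.exp (-p * b x) * ‖fderiv ℝ u x‖ ^ 2) /
  (∫ x in Ω, Real.exp (-p * b x) * u x ^ 2)

/-- Test function attached to a single well. -/
lemma single_well {n : ℕ} (b : EuclideanSpace ℝ (Fin n) → ℝ) (K : NNReal)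
    (hb : LipschitzWith K b) (W : Set (EuclideanSpace ℝ (Fin n)))
    (hne : W.Nonempty) (ho : IsOpen W) (hbd : Bornology.IsBounded W)
    (ω₀ : ℝ) (ω : ℝ) (hω : ω ∈ Set.Ioo 0 ω₀)
    (hdepth : ω₀ ≤ sInf (b '' frontier W) - sInf (b '' closure W)) :
    ∃ (t : ℝ) (u : EuclideanSpace ℝ (Fin n) → ℝ) (L : NNReal)
      (V : Set (EuclideanSpace ℝ (Fin n))),
      LipschitzWith L u ∧ (∀ x ∉ closure W, u x = 0) ∧
      (∀ x, fderiv ℝ u x ≠ 0 → t + ω ≤ b x) ∧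
      IsOpen V ∧ V.Nonempty ∧ V ⊆ W ∧ (∀ x ∈ V, u x = 1) ∧ (∀ x ∈ V, b x ≤ t) := by
  obtain ⟨hω1, hω2⟩ := hω
  have hbc : Continuous b := hb.continuous
  have hcpt : IsCompact (closure W) := hbd.isCompact_closure
  have hbb : BddBelow (b '' closure W) := (hcpt.image hbc).bddBelow
  set a := sInf (b '' closure W) with ha
  set β := sInf (b '' frontier W) with hβ
  have hfr : ∀ x ∈ frontier W, β ≤ b x := fun x hx =>
    csInf_le (hbb.mono (Set.image_mono frontier_subset_closure)) ⟨x, hx, rfl⟩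
  obtain ⟨ε, hε, hεe⟩ : ∃ ε : ℝ, 0 < ε ∧ ε = (ω₀ - ω) / 2 := ⟨_, by linarith, rfl⟩
  set g : EuclideanSpace ℝ (Fin n) → ℝ := fun x => max 0 (min 1 ((β - b x) / ε)) with hg
  set L : NNReal := ⟨ε⁻¹, by positivity⟩ * K with hL
  have hgL : LipschitzWith L g := by
    refine LipschitzWith.const_max (LipschitzWith.const_min ?_ 1) 0
    refine LipschitzWith.of_dist_le_mul fun x y => ?_
    have h := hb.dist_le_mul x y
    rw [Real.dist_eq] at h ⊢
    have e : (β - b x) / ε - (β - b y) / ε = - (ε⁻¹ * (b x - b y)) := by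
      field_simp; ring
    rw [e, abs_neg, abs_mul, abs_of_pos (inv_pos.2 hε)]
    have : ((L : NNReal) : ℝ) = ε⁻¹ * K := by rw [hL]; push_cast; rfl
    rw [this, mul_assoc]
    exact mul_le_mul_of_nonneg_left h (by positivity)
  have hgfr : ∀ x ∈ frontier W, g x = 0 := by
    intro x hx
    have := hfr x hx
    have h2 : (β - b x) / ε ≤ 0 := div_nonpos_of_nonpos_of_nonneg (by linarith) hε.le
    exact max_eq_left ((min_le_right _ _).trans h2)
  have hg1 : ∀ x, b x ≤ β - ε → g x = 1 := by
    intro x hx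
    have h2 : 1 ≤ (β - b x) / ε := by rw [le_div_iff₀ hε]; linarith
    simp only [hg]
    rw [min_eq_left h2]; simp
  have hcross : ∀ x ∈ W, ∀ y ∉ W, dist (g x) 0 ≤ L * dist x y := by
    intro x hx y hy
    obtain ⟨z, hz, hzf⟩ : ∃ z ∈ segment ℝ x y, z ∈ frontier W := by
      by_contra hno
      push Not at hno
      have hyc : ∀ z ∈ segment ℝ x y, z ∉ W → z ∉ closure W := by
        intro z hz hzW hc
        exact hno z hz (by rw [ho.frontier_eq]; exact ⟨hc, hzW⟩)
      obtain ⟨z, -, hz1, hz2⟩ := (convex_segment (𝕜 := ℝ) x y).isPreconnected W (closure W)ᶜ ho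
        isClosed_closure.isOpen_compl
        (fun z hz => by
          by_cases h : z ∈ W
          · exact Or.inl h
          · exact Or.inr (hyc z hz h))
        ⟨x, left_mem_segment ℝ x y, hx⟩
        ⟨y, right_mem_segment ℝ x y, hyc y (right_mem_segment ℝ x y) hy⟩
      exact hz2 (subset_closure hz1)
    have h1 := hgL.dist_le_mul x z
    rw [hgfr z hzf] at h1
    refine h1.trans (mul_le_mul_of_nonneg_left ?_ L.2)
    have := dist_add_dist_of_mem_segment hz
    linarith [dist_nonneg (x := z) (y := y)]
  refine ⟨a + ε, W.indicator g, L, W ∩ {x | b x < a + ε}, ?_, ?_, ?_, ?_, ?_, ?_, ?_, ?_⟩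
  · refine LipschitzWith.of_dist_le_mul fun x y => ?_
    by_cases hx : x ∈ W <;> by_cases hy : y ∈ W
    · simpa [hx, hy] using hgL.dist_le_mul x y
    · simpa [hx, hy] using hcross x hx y hy
    · have := hcross y hy x hx
      rw [dist_comm, dist_comm y x] at this
      simpa [hx, hy] using this
    · simp only [Set.indicator_of_notMem hx, Set.indicator_of_notMem hy, dist_self]
      positivity
  · intro x hx
    exact Set.indicator_of_notMem (fun h => hx (subset_closure h)) _
  · intro x hx
    by_contra hlt
    push Not at hlt
    apply hx
    have hlt' : b x < β - ε := by linarith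
    by_cases hxW : x ∈ W
    · have : W.indicator g =ᶠ[nhds x] fun _ => (1 : ℝ) := by
        filter_upwards [ho.mem_nhds hxW, (isOpen_lt hbc continuous_const).mem_nhds hlt'] with y h1 h2
        rw [Set.indicator_of_mem h1]
        exact hg1 y (le_of_lt h2)
      rw [this.fderiv_eq]; simp
    · have hxc : x ∉ closure W := by
        intro hc
        have : x ∈ frontier W := by rw [ho.frontier_eq]; exact ⟨hc, hxW⟩
        linarith [hfr x this]
      have : W.indicator g =ᶠ[nhds x] fun _ => (0 : ℝ) := by
        filter_upwards [isClosed_closure.isOpen_compl.mem_nhds hxc] with y h1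
        exact Set.indicator_of_notMem (fun h => h1 (subset_closure h)) _
      rw [this.fderiv_eq]; simp
  · exact ho.inter (isOpen_lt hbc continuous_const)
  · obtain ⟨_, ⟨x, hx, rfl⟩, hlt⟩ := exists_lt_of_csInf_lt (hne.closure.image b)
      (show a < a + ε by linarith)
    obtain ⟨y, hy⟩ := mem_closure_iff.1 hx _ (isOpen_lt hbc continuous_const) hlt
    exact ⟨y, hy.2, hy.1⟩
  · exact Set.inter_subset_left
  · intro x hx
    rw [Set.indicator_of_mem hx.1]
    apply hg1
    have := hx.2
    simp only [Set.mem_ofPred_eq] at this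
    linarith
  · intro x hx
    exact le_of_lt hx.2

theorem exponential_decay_of_m_potential_wells {n m : ℕ} (hn : 1 ≤ n) (hm : 1 ≤ m)
    (Ω : Set (EuclideanSpace ℝ (Fin n)))
    (hΩne : Ω.Nonempty) (hΩo : IsOpen Ω) (hΩbd : Bornology.IsBounded Ω)
    (b : EuclideanSpace ℝ (Fin n) → ℝ) (K : NNReal) (hb : LipschitzWith K b)
    (W : Fin m → Set (EuclideanSpace ℝ (Fin n)))
    (hWne : ∀ j, (W j).Nonempty) (hWo : ∀ j, IsOpen (W j)) (hWsub : ∀ j, W j ⊆ Ω)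
    (hdisj : ∀ i j, i ≠ j → closure (W i) ∩ closure (W j) = ∅)
    (hwell : ∀ j, sInf (b '' closure (W j)) < sInf (b '' frontier (W j)))
    (ω₀ : ℝ) (hω₀ : 0 < ω₀)
    (hdepth : ∀ j, ω₀ ≤ sInf (b '' frontier (W j)) - sInf (b '' closure (W j)))
    (ω : ℝ) (hω : ω ∈ Set.Ioo 0 ω₀) :
    ∃ C > 0, ∃ u : Fin m → (EuclideanSpace ℝ (Fin n) → ℝ),
      (∀ j, u j ≠ 0 ∧ (∃ Kj, LipschitzWith Kj (u j)) ∧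
        (∀ x ∉ closure (W j), u j x = 0)) ∧
      ∀ p : ℝ, 0 ≤ p → ∀ c : Fin m → ℝ, c ≠ 0 →
        Ipb Ω b p (fun x => ∑ j, c j * u j x) ≤ C * Real.exp (-ω * p) := by
  have hWbd : ∀ j, Bornology.IsBounded (W j) := fun j => hΩbd.subset (hWsub j)
  have hs := fun j => single_well b K hb (W j) (hWne j) (hWo j) (hWbd j) ω₀ ω hω (hdepth j)
  choose t u L V hLip hzero hfd hVo hVne hVW hV1 hVb using hs
  have hbc : Continuous b := hb.continuous
  have hΩfin : volume Ω < ⊤ := hΩbd.measure_lt_top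
  have hΩm : MeasurableSet Ω := hΩo.measurableSet
  have hVfin : ∀ j, volume (V j) < ⊤ := fun j =>
    ((hWbd j).subset (hVW j)).measure_lt_top
  have hv : ∀ j, 0 < volume.real (V j) := fun j =>
    ENNReal.toReal_pos ((hVo j).measure_pos volume (hVne j)).ne' (hVfin j).ne
  set M : ℝ := ∑ j, (L j : ℝ) ^ 2 / volume.real (V j) with hM
  have hM0 : 0 ≤ M := Finset.sum_nonneg fun j _ => div_nonneg (sq_nonneg _) (hv j).le
  have hLM : ∀ j, (L j : ℝ) ^ 2 ≤ M * volume.real (V j) := by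
    intro j
    rw [← div_le_iff₀ (hv j)]
    exact Finset.single_le_sum (f := fun j => (L j : ℝ) ^ 2 / volume.real (V j))
      (fun j _ => div_nonneg (sq_nonneg _) (hv j).le) (Finset.mem_univ j)
  have hother : ∀ i j, i ≠ j → ∀ x ∈ closure (W j), x ∉ closure (W i) := by
    intro i j hij x hx hx'
    have : x ∈ closure (W i) ∩ closure (W j) := ⟨hx', hx⟩
    rw [hdisj i j hij] at this
    exact this
  have hVol : 0 ≤ volume.real Ω := measureReal_nonneg
  refine ⟨volume.real Ω * M + 1, by positivity, u, ?_, ?_⟩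
  · intro j
    refine ⟨?_, ⟨L j, hLip j⟩, hzero j⟩
    obtain ⟨x, hx⟩ := hVne j
    intro h
    have := hV1 j x hx
    rw [h] at this
    simp at this
  intro p hp c hc
  set w : EuclideanSpace ℝ (Fin n) → ℝ := fun x => ∑ j, c j * u j x with hw
  set S : ℝ := ∑ j, c j ^ 2 * Real.exp (-p * t j) * volume.real (V j) with hS
  have hSpos : 0 < S := by
    obtain ⟨j, hj⟩ := Function.ne_iff.1 hc
    refine Finset.sum_pos' (fun i _ => ?_) ⟨j, Finset.mem_univ j, ?_⟩
    · have := hv i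
      positivity
    · have := hv j
      have : c j ≠ 0 := hj
      positivity
  have hwc : Continuous w :=
    continuous_finsetSum _ fun j _ => continuous_const.mul (hLip j).continuous
  -- numerator
  have hpt : ∀ x, Real.exp (-p * b x) * ‖fderiv ℝ w x‖ ^ 2
      ≤ Real.exp (-ω * p) * (M * S) := by
    intro x
    have hR : 0 ≤ Real.exp (-ω * p) * (M * S) := by positivity
    by_cases hx : fderiv ℝ w x = 0
    · rw [hx]; simpa using hR
    have hex : ∃ j, x ∈ closure (W j) := by
      by_contra hno
      push Not at hno
      apply hx
      have : w =ᶠ[nhds x] fun _ => (0 : ℝ) := by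
        have : ∀ j, ∀ᶠ y in nhds x, y ∉ closure (W j) := fun j =>
          isClosed_closure.isOpen_compl.mem_nhds (hno j)
        filter_upwards [Filter.eventually_all.2 this] with y hy
        exact Finset.sum_eq_zero fun j _ => by rw [hzero j y (hy j), mul_zero]
      rw [this.fderiv_eq]; simp
    obtain ⟨j, hj⟩ := hex
    have hev : w =ᶠ[nhds x] (c j) • u j := by
      have : ∀ i, ∀ᶠ y in nhds x, i ≠ j → y ∉ closure (W i) := by
        intro i
        by_cases hij : i = j
        · simp [hij]
        · filter_upwards [isClosed_closure.isOpen_compl.mem_nhds (hother i j hij x hj)] with y hy _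
          exact hy
      filter_upwards [Filter.eventually_all.2 this] with y hy
      simp only [hw, Pi.smul_apply, smul_eq_mul]
      exact Finset.sum_eq_single j (fun i _ hij => by rw [hzero i y (hy i hij), mul_zero])
        (fun h => absurd (Finset.mem_univ j) h)
    have hder : fderiv ℝ w x = c j • fderiv ℝ (u j) x := by
      rw [hev.fderiv_eq, fderiv_const_smul_field]
      rfl
    have hne : fderiv ℝ (u j) x ≠ 0 := by
      intro h
      apply hx
      rw [hder, h, smul_zero]
    have hbx := hfd j x hne
    have hn : ‖fderiv ℝ (u j) x‖ ≤ L j := norm_fderiv_le_of_lipschitz ℝ (hLip j)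
    have hexp : Real.exp (-p * b x) ≤ Real.exp (-ω * p) * Real.exp (-p * t j) := by
      rw [← Real.exp_add]
      apply Real.exp_le_exp.2
      nlinarith [mul_le_mul_of_nonneg_left hbx hp]
    have hnn : ‖fderiv ℝ w x‖ ^ 2 ≤ c j ^ 2 * (M * volume.real (V j)) := by
      rw [hder, norm_smul, mul_pow, Real.norm_eq_abs, sq_abs]
      refine mul_le_mul_of_nonneg_left (le_trans ?_ (hLM j)) (sq_nonneg _)
      gcongr
    have hterm : c j ^ 2 * Real.exp (-p * t j) * volume.real (V j) ≤ S :=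
      Finset.single_le_sum (f := fun j => c j ^ 2 * Real.exp (-p * t j) * volume.real (V j))
        (fun i _ => by have := hv i; positivity) (Finset.mem_univ j)
    calc _ ≤ (Real.exp (-ω * p) * Real.exp (-p * t j)) * (c j ^ 2 * (M * volume.real (V j))) := by
          gcongr
      _ = Real.exp (-ω * p) * (M * (c j ^ 2 * Real.exp (-p * t j) * volume.real (V j))) := by ring
      _ ≤ _ := by gcongr
  have hnum : (∫ x in Ω, Real.exp (-p * b x) * ‖fderiv ℝ w x‖ ^ 2)
      ≤ Real.exp (-ω * p) * (M * S) * volume.real Ω := by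
    refine (Real.le_norm_self _).trans ?_
    refine norm_setIntegral_le_of_norm_le_const hΩfin fun x _ => ?_
    rw [Real.norm_eq_abs, abs_of_nonneg (by positivity)]
    exact hpt x
  -- denominator
  have hden : S ≤ ∫ x in Ω, Real.exp (-p * b x) * w x ^ 2 := by
    have hint : ∀ j ∈ Finset.univ, Integrable ((V j).indicator
        fun _ => c j ^ 2 * Real.exp (-p * t j)) (volume.restrict Ω) := by
      intro j _
      refine (IntegrableOn.integrable_indicator ?_ (hVo j).measurableSet).restrict
      exact integrableOn_const (hVfin j).ne
    have hSe : S = ∫ x in Ω, ∑ j, (V j).indicator (fun _ => c j ^ 2 * Real.exp (-p * t j)) x := by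
      rw [integral_finsetSum _ hint]
      refine Finset.sum_congr rfl fun j _ => ?_
      rw [setIntegral_indicator (hVo j).measurableSet,
        Set.inter_eq_right.2 ((hVW j).trans (hWsub j)), setIntegral_const, smul_eq_mul, mul_comm]
    rw [hSe]
    refine integral_mono (integrable_finsetSum _ hint) ?_ ?_
    · have hcont : Continuous fun x => Real.exp (-p * b x) * w x ^ 2 := by fun_prop
      exact (hcont.continuousOn.integrableOn_compact hΩbd.isCompact_closure).mono_set
        subset_closure
    · intro x
      show ∑ j, (V j).indicator (fun _ => c j ^ 2 * Real.exp (-p * t j)) x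
        ≤ Real.exp (-p * b x) * w x ^ 2
      by_cases hex : ∃ j, x ∈ V j
      · obtain ⟨j, hj⟩ := hex
        have hcl : x ∈ closure (W j) := subset_closure (hVW j hj)
        have h1 : w x = c j := by
          simp only [hw]
          rw [Finset.sum_eq_single j
            (fun i _ hij => by rw [hzero i x (hother i j hij x hcl), mul_zero])
            (fun h => absurd (Finset.mem_univ j) h), hV1 j x hj, mul_one]
        rw [h1, Finset.sum_eq_single j (fun i _ hij => Set.indicator_of_notMem
            (fun h => hother i j hij x hcl (subset_closure (hVW i h))) _)
            (fun h => absurd (Finset.mem_univ j) h), Set.indicator_of_mem hj, mul_comm]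
        refine mul_le_mul_of_nonneg_right (Real.exp_le_exp.2 ?_) (sq_nonneg _)
        nlinarith [mul_le_mul_of_nonneg_left (hVb j x hj) hp]
      · push Not at hex
        rw [Finset.sum_eq_zero fun j _ => Set.indicator_of_notMem (hex j) _]
        positivity
  unfold Ipb
  rw [div_le_iff₀ (hSpos.trans_le hden)]
  refine hnum.trans ?_
  calc _ = volume.real Ω * M * Real.exp (-ω * p) * S := by ring
    _ ≤ (volume.real Ω * M + 1) * Real.exp (-ω * p) * S := by gcongr; linarith
    _ ≤ _ := by gcongr
end

section
/- Let l > 0 and let b : [−l, l] → ℝ be Lipschitz continuous and even. Set b₁ := min_{[0,l]} b, b₂ := max_{[0,l]} b, b₀ := b₂ − b₁, B₁ := {x ∈ [0,l] : b(x) = b₁}, B₂ := {x ∈ [0,l] : b(x) = b₂}, and assume max B₁ < min B₂. Then lim_{p→∞} (1/p) log(1/λ₁(p)) = b₀; equivalently, for every ε ∈ (0, b₀) there exists p₀ > 0 such that e^{−p(b₀+ε)} ≤ λ₁(p) ≤ e^{−p(b₀−ε)} for all p ≥ p₀. -/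
open MeasureTheory intervalIntegral

/-- The variational principal eigenvalue `λ₁(p)` of the one-dimensional drift operator
`-u'' + p b' u'` on `(-l, l)` with Dirichlet boundary conditions: the infimum of the
weighted Rayleigh quotient over nonzero Lipschitz functions vanishing at `±l`. -/
noncomputable def lam1d (l : ℝ) (b : ℝ → ℝ) (p : ℝ) : ℝ :=
  sInf { r | ∃ u : ℝ → ℝ, (∃ K, LipschitzWith K u) ∧ u (-l) = 0 ∧ u l = 0 ∧
    (∃ x ∈ Set.Icc (-l) l, u x ≠ 0) ∧
    r = (∫ x in (-l)..l, Real.exp (-p * b x) * deriv u x ^ 2) /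
        (∫ x in (-l)..l, Real.exp (-p * b x) * u x ^ 2) }

open Set in
lemma aux_int_u (l : ℝ) (hl : 0 < l) (b : ℝ → ℝ) (K : NNReal)
    (hb : LipschitzOnWith K b (Set.Icc (-l) l)) (p : ℝ) (u : ℝ → ℝ) (hu : Continuous u) :
    ContinuousOn (fun x => Real.exp (-p * b x) * u x ^ 2) (Icc (-l) l) := by
  have := hb.continuousOn
  fun_prop

open Set in
lemma aux_int_du (l : ℝ) (hl : 0 < l) (b : ℝ → ℝ) (K : NNReal)
    (hb : LipschitzOnWith K b (Set.Icc (-l) l)) (p : ℝ) (u : ℝ → ℝ) (C : NNReal)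
    (hu : LipschitzWith C u) :
    IntervalIntegrable (fun x => Real.exp (-p * b x) * deriv u x ^ 2) volume (-l) l := by
  have hle : -l ≤ l := by linarith
  have h1 := hb.continuousOn
  have h2 : ContinuousOn (fun x => Real.exp (-p * b x)) (uIcc (-l) l) := by
    rw [uIcc_of_le hle]; fun_prop
  refine IntervalIntegrable.continuousOn_mul ?_ h2
  rw [intervalIntegrable_iff]
  refine Measure.integrableOn_of_bounded (M := (C:ℝ)^2) (by simp) ?_ ?_
  · exact ((measurable_deriv u).pow_const 2).aestronglyMeasurable
  · refine Filter.Eventually.of_forall fun x => ?_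
    rw [norm_pow]
    exact pow_le_pow_left₀ (norm_nonneg _) (norm_deriv_le_of_lipschitz hu) 2

open Set in
lemma aux_sq_bound (l : ℝ) (hl : 0 < l) (u : ℝ → ℝ) (C : NNReal)
    (hu : LipschitzWith C u) (h0 : u (-l) = 0) (x : ℝ) (hx : x ∈ Icc (-l) l) :
    u x ^ 2 ≤ 2 * l * ∫ t in (-l)..l, deriv u t ^ 2 := by
  have hle : -l ≤ l := by linarith
  have hsq : IntervalIntegrable (fun x => deriv u x ^ 2) volume (-l) l := by
    have := aux_int_du l hl (fun _ => 0) 0 (LipschitzWith.const _).lipschitzOnWith 0 u C hu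
    simpa using this
  have hac : AbsolutelyContinuousOnInterval u (-l) x :=
    (hu.lipschitzOnWith (s := uIcc (-l) x)).absolutelyContinuousOnInterval
  have hI := hac.integral_deriv_eq_sub
  have hdi := hac.intervalIntegrable_deriv
  rw [h0, sub_zero] at hI
  have hsub : uIcc (-l) x ⊆ uIcc (-l) l := by
    rw [uIcc_of_le hx.1, uIcc_of_le hle]; exact Icc_subset_Icc le_rfl hx.2
  have hmono : ∫ t in (-l)..x, deriv u t ^ 2 ≤ ∫ t in (-l)..l, deriv u t ^ 2 := by
    refine integral_mono_interval le_rfl hx.1 hx.2 ?_ hsq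
    exact Filter.Eventually.of_forall fun t => sq_nonneg (deriv u t)
  set c := u x / (2 * l) with hc
  have hcs : ∫ t in (-l)..x, (2 * c * deriv u t - c ^ 2) ≤ ∫ t in (-l)..x, deriv u t ^ 2 := by
    refine integral_mono_on hx.1 ((hdi.const_mul _).sub (by simp)) (hsq.mono_set hsub) ?_
    intro t _
    nlinarith [sq_nonneg (deriv u t - c)]
  rw [integral_sub (hdi.const_mul _) (by simp), intervalIntegral.integral_const_mul, hI] at hcs
  simp only [intervalIntegral.integral_const, smul_eq_mul] at hcs
  have hcu : u x = 2 * l * c := by rw [hc]; field_simp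
  have hx2 : (x - -l) * c ^ 2 ≤ 2 * l * c ^ 2 := by
    have := hx.2
    exact mul_le_mul_of_nonneg_right (by linarith) (sq_nonneg _)
  have h3 : 2 * l * c ^ 2 ≤ ∫ t in (-l)..l, deriv u t ^ 2 := by
    rw [hcu] at hcs; nlinarith
  calc u x ^ 2 = 2 * l * (2 * l * c ^ 2) := by rw [hcu]; ring
    _ ≤ _ := mul_le_mul_of_nonneg_left h3 (by linarith)

open Set in
lemma aux_lower (l : ℝ) (hl : 0 < l) (b : ℝ → ℝ) (K : NNReal)
    (hb : LipschitzOnWith K b (Set.Icc (-l) l)) (b1 b2 : ℝ)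
    (hbd : ∀ x ∈ Icc (-l) l, b1 ≤ b x ∧ b x ≤ b2) (p : ℝ) (hp : 0 ≤ p)
    (u : ℝ → ℝ) (C : NNReal) (hu : LipschitzWith C u) (h0 : u (-l) = 0)
    (hne : ∃ x ∈ Icc (-l) l, u x ≠ 0) :
    (4 * l ^ 2 * Real.exp (p * (b2 - b1)))⁻¹ ≤
      (∫ x in (-l)..l, Real.exp (-p * b x) * deriv u x ^ 2) /
        (∫ x in (-l)..l, Real.exp (-p * b x) * u x ^ 2) := by
  have hle : -l ≤ l := by linarith
  have hcont := aux_int_u l hl b K hb p u hu.continuous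
  have hNpos : 0 < ∫ x in (-l)..l, Real.exp (-p * b x) * u x ^ 2 := by
    refine integral_pos (by linarith) hcont (fun x _ => by positivity) ?_
    obtain ⟨x, hx, hx0⟩ := hne
    exact ⟨x, hx, by positivity⟩
  have hsq : IntervalIntegrable (fun x => deriv u x ^ 2) volume (-l) l := by
    have := aux_int_du l hl (fun _ => 0) 0 (LipschitzWith.const _).lipschitzOnWith 0 u C hu
    simpa using this
  set E := ∫ t in (-l)..l, deriv u t ^ 2 with hE
  have hD : Real.exp (-p * b2) * E ≤ ∫ x in (-l)..l, Real.exp (-p * b x) * deriv u x ^ 2 := by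
    rw [hE, ← intervalIntegral.integral_const_mul]
    refine integral_mono_on hle (hsq.const_mul _) (aux_int_du l hl b K hb p u C hu) ?_
    intro x hx
    refine mul_le_mul_of_nonneg_right (Real.exp_le_exp.2 ?_) (sq_nonneg _)
    nlinarith [(hbd x hx).2]
  have hN : ∫ x in (-l)..l, Real.exp (-p * b x) * u x ^ 2 ≤
      4 * l ^ 2 * (Real.exp (-p * b1) * E) := by
    have : ∫ x in (-l)..l, Real.exp (-p * b x) * u x ^ 2 ≤
        ∫ x in (-l)..l, Real.exp (-p * b1) * (2 * l * E) := by
      refine integral_mono_on hle (hcont.intervalIntegrable_of_Icc hle) (by simp) ?_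
      intro x hx
      refine mul_le_mul (Real.exp_le_exp.2 ?_) (aux_sq_bound l hl u C hu h0 x hx)
        (sq_nonneg _) (Real.exp_pos _).le
      nlinarith [(hbd x hx).1]
    refine this.trans (le_of_eq ?_)
    simp only [intervalIntegral.integral_const, smul_eq_mul]; ring
  rw [le_div_iff₀ hNpos, inv_mul_le_iff₀ (by positivity)]
  refine hN.trans ?_
  have : Real.exp (-p * b1) = Real.exp (p * (b2 - b1)) * Real.exp (-p * b2) := by
    rw [← Real.exp_add]; ring_nf
  rw [this, mul_assoc, mul_assoc]
  have := mul_le_mul_of_nonneg_left hD (by positivity : 0 ≤ 4 * l ^ 2 * Real.exp (p * (b2 - b1)))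
  linarith

open Set in
lemma aux_upper (l : ℝ) (hl : 0 < l) (b : ℝ → ℝ) (K : NNReal)
    (hb : LipschitzOnWith K b (Set.Icc (-l) l))
    (hbeven : ∀ x ∈ Set.Icc (-l) l, b (-x) = b x) (x1 x2 d : ℝ) (hd : 0 < d)
    (h1 : 0 ≤ x1) (h12 : x1 + 2 * d ≤ x2) (h2 : x2 ≤ l) (p : ℝ) (hp : 0 ≤ p) :
    ∃ r, (∃ u : ℝ → ℝ, (∃ K, LipschitzWith K u) ∧ u (-l) = 0 ∧ u l = 0 ∧
      (∃ x ∈ Set.Icc (-l) l, u x ≠ 0) ∧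
      r = (∫ x in (-l)..l, Real.exp (-p * b x) * deriv u x ^ 2) /
        (∫ x in (-l)..l, Real.exp (-p * b x) * u x ^ 2)) ∧
      r ≤ 2 * l / d ^ 3 * Real.exp (-p * (b x2 - b x1 - 2 * K * d)) := by
  have hle : -l ≤ l := by linarith
  set u : ℝ → ℝ := fun x => max 0 (min 1 ((x2 - |x|) / d)) with hudef
  have hlip : LipschitzWith (Real.toNNReal (1 / d)) u := by
    have ha : LipschitzWith (Real.toNNReal (1 / d)) (fun x : ℝ => (x2 - |x|) / d) := by
      refine LipschitzWith.of_dist_le_mul fun x y => ?_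
      rw [Real.coe_toNNReal _ (by positivity), Real.dist_eq, Real.dist_eq]
      have : (x2 - |x|) / d - (x2 - |y|) / d = 1 / d * (|y| - |x|) := by ring
      rw [this, abs_mul, abs_of_pos (by positivity : 0 < 1 / d), abs_sub_comm x y]
      exact mul_le_mul_of_nonneg_left (abs_abs_sub_abs_le _ _) (by positivity)
    exact (ha.const_min 1).const_max 0
  have hbl : ∀ x ∈ Icc (-l) l, ∀ y ∈ Icc (-l) l, b x ≤ b y + K * |x - y| := by
    intro x hx y hy
    have := hb.dist_le_mul x hx y hy
    rw [Real.dist_eq, Real.dist_eq] at this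
    linarith [le_abs_self (b x - b y)]
  have hu1 : ∀ x, |x| ≤ x2 - d → u x = 1 := by
    intro x hx
    have : 1 ≤ (x2 - |x|) / d := by rw [le_div_iff₀ hd]; linarith
    simp [hudef, min_eq_left this]
  have hu0 : ∀ x, x2 ≤ |x| → u x = 0 := by
    intro x hx
    have : (x2 - |x|) / d ≤ 0 := div_nonpos_of_nonpos_of_nonneg (by linarith) hd.le
    simp only [hudef]
    exact max_eq_left ((min_le_right _ _).trans this)
  have hx1 : x1 ∈ Icc (-l) l := ⟨by linarith, by linarith⟩
  have hx2 : x2 ∈ Icc (-l) l := ⟨by linarith, by linarith⟩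
  refine ⟨_, ⟨u, ⟨_, hlip⟩, hu0 _ ?_, hu0 _ ?_, ⟨x1, hx1, ?_⟩, rfl⟩, ?_⟩
  · rw [abs_neg, abs_of_pos hl]; exact h2
  · rw [abs_of_pos hl]; exact h2
  · rw [hu1 x1 (by rw [abs_of_nonneg h1]; linarith)]; exact one_ne_zero
  have hcont := aux_int_u l hl b K hb p u hlip.continuous
  have hN : d * Real.exp (-p * (b x1 + K * d)) ≤
      ∫ x in (-l)..l, Real.exp (-p * b x) * u x ^ 2 := by
    have ha : ∫ x in x1..(x1 + d), Real.exp (-p * b x) * u x ^ 2 ≤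
        ∫ x in (-l)..l, Real.exp (-p * b x) * u x ^ 2 := by
      refine integral_mono_interval (by linarith) (by linarith) (by linarith) ?_
        (hcont.intervalIntegrable_of_Icc hle)
      exact Filter.Eventually.of_forall fun t => by positivity
    refine le_trans ?_ ha
    have hb' : ∫ x in x1..(x1 + d), Real.exp (-p * (b x1 + K * d)) ≤
        ∫ x in x1..(x1 + d), Real.exp (-p * b x) * u x ^ 2 := by
      refine integral_mono_on (by linarith) (by simp)
        ((hcont.mono (Icc_subset_Icc (by linarith) (by linarith))).intervalIntegrable_of_Icc
          (by linarith)) ?_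
      intro x hx
      have hxx : x ∈ Icc (-l) l := ⟨by linarith [hx.1], by linarith [hx.2]⟩
      rw [hu1 x (by rw [abs_of_nonneg (by linarith [hx.1])]; linarith [hx.2]), one_pow, mul_one]
      refine Real.exp_le_exp.2 ?_
      have h3 := hbl x hxx x1 hx1
      have h4 : |x - x1| ≤ d := by rw [abs_of_nonneg (by linarith [hx.1])]; linarith [hx.2]
      have h5 := mul_le_mul_of_nonneg_left h4 K.coe_nonneg
      have h6 := mul_le_mul_of_nonneg_left (show b x ≤ b x1 + K * d by linarith) hp
      linarith
    refine le_trans (le_of_eq ?_) hb'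
    simp
  have hD : ∫ x in (-l)..l, Real.exp (-p * b x) * deriv u x ^ 2 ≤
      2 * l * (Real.exp (-p * (b x2 - K * d)) * (1 / d) ^ 2) := by
    have ha : ∫ x in (-l)..l, Real.exp (-p * b x) * deriv u x ^ 2 ≤
        ∫ x in (-l)..l, Real.exp (-p * (b x2 - K * d)) * (1 / d) ^ 2 := by
      refine integral_mono_on hle (aux_int_du l hl b K hb p u _ hlip) (by simp) ?_
      intro x hx
      by_cases hin : |x| < x2 - d
      · have : u =ᶠ[nhds x] fun _ => 1 := by
          filter_upwards [(isOpen_lt continuous_abs continuous_const).mem_nhds hin] with y hy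
          exact hu1 y (le_of_lt hy)
        rw [this.deriv_eq]
        simp; positivity
      by_cases hout : x2 < |x|
      · have : u =ᶠ[nhds x] fun _ => 0 := by
          filter_upwards [(isOpen_lt continuous_const continuous_abs).mem_nhds hout] with y hy
          exact hu0 y (le_of_lt hy)
        rw [this.deriv_eq]
        simp; positivity
      push Not at hin hout
      have habs : b |x| = b x := by
        rcases abs_choice x with h | h <;> rw [h]
        exact hbeven x hx
      have hxx : |x| ∈ Icc (-l) l := ⟨by linarith [abs_nonneg x], by linarith⟩
      have h3 := hbl x2 hx2 _ hxx
      rw [habs] at h3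
      have h4 : abs (x2 - |x|) ≤ d := by rw [abs_of_nonneg (by linarith)]; linarith
      have h5 := mul_le_mul_of_nonneg_left h4 K.coe_nonneg
      have h6 := mul_le_mul_of_nonneg_left (show b x2 - K * d ≤ b x by linarith) hp
      refine mul_le_mul (Real.exp_le_exp.2 (by linarith)) ?_ (sq_nonneg _) (Real.exp_pos _).le
      have h7 := norm_deriv_le_of_lipschitz (x₀ := x) hlip
      rw [Real.coe_toNNReal _ (by positivity), Real.norm_eq_abs] at h7
      rw [← sq_abs]
      exact pow_le_pow_left₀ (abs_nonneg _) h7 2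
    refine ha.trans (le_of_eq ?_)
    simp only [intervalIntegral.integral_const, smul_eq_mul]; ring
  have hpos : 0 < d * Real.exp (-p * (b x1 + K * d)) := by positivity
  rw [div_le_iff₀ (hpos.trans_le hN)]
  refine hD.trans ?_
  refine le_trans (le_of_eq ?_) (mul_le_mul_of_nonneg_left hN (by positivity))
  have : Real.exp (-p * (b x2 - K * d)) = Real.exp (-p * (b x2 - b x1 - 2 * K * d)) *
      Real.exp (-p * (b x1 + K * d)) := by rw [← Real.exp_add]; ring_nf
  rw [this]; field_simp

theorem principal_eigenvalue_log_asymptotics_1d (l : ℝ) (hl : 0 < l)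
    (b : ℝ → ℝ) (K : NNReal) (hb : LipschitzOnWith K b (Set.Icc (-l) l))
    (hbeven : ∀ x ∈ Set.Icc (-l) l, b (-x) = b x)
    (hB : sSup {x ∈ Set.Icc 0 l | b x = sInf (b '' Set.Icc 0 l)} <
          sInf {x ∈ Set.Icc 0 l | b x = sSup (b '' Set.Icc 0 l)}) :
    Filter.Tendsto (fun p => (1 / p) * Real.log (1 / lam1d l b p))
      Filter.atTop (nhds (sSup (b '' Set.Icc 0 l) - sInf (b '' Set.Icc 0 l))) := by
  have hsub : Set.Icc 0 l ⊆ Set.Icc (-l) l := Set.Icc_subset_Icc (by linarith) le_rfl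
  have hcont : ContinuousOn b (Set.Icc 0 l) := hb.continuousOn.mono hsub
  have hne : (Set.Icc 0 l).Nonempty := ⟨0, le_rfl, hl.le⟩
  have hcomp : IsCompact (b '' Set.Icc 0 l) := isCompact_Icc.image_of_continuousOn hcont
  obtain ⟨x1, hx1, hbx1⟩ := hcomp.sInf_mem (hne.image b)
  obtain ⟨x2, hx2, hbx2⟩ := hcomp.sSup_mem (hne.image b)
  have hbdA := hcomp.bddAbove
  have hbdB := hcomp.bddBelow
  set b1 := sInf (b '' Set.Icc 0 l) with hb1
  set b2 := sSup (b '' Set.Icc 0 l) with hb2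
  have h12 : x1 < x2 := by
    have hA : x1 ≤ sSup {x ∈ Set.Icc 0 l | b x = b1} :=
      le_csSup ⟨l, fun x hx => hx.1.2⟩ ⟨hx1, hbx1⟩
    have hA' : sInf {x ∈ Set.Icc 0 l | b x = b2} ≤ x2 :=
      csInf_le ⟨0, fun x hx => hx.1.1⟩ ⟨hx2, hbx2⟩
    linarith
  have hbd : ∀ x ∈ Set.Icc (-l) l, b1 ≤ b x ∧ b x ≤ b2 := by
    intro x hx
    have habs : b |x| = b x := by
      rcases abs_choice x with h | h <;> rw [h]
      exact hbeven x hx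
    have hm : |x| ∈ Set.Icc 0 l := ⟨abs_nonneg _, abs_le.2 hx⟩
    rw [← habs]
    exact ⟨csInf_le hbdB ⟨_, hm, rfl⟩, le_csSup hbdA ⟨_, hm, rfl⟩⟩
  have hlow : ∀ p, 0 ≤ p → (4 * l ^ 2 * Real.exp (p * (b2 - b1)))⁻¹ ≤ lam1d l b p := by
    intro p hp
    refine le_csInf ?_ ?_
    · obtain ⟨r, hr, _⟩ := aux_upper l hl b K hb hbeven x1 x2 ((x2 - x1) / 2) (by linarith)
        hx1.1 (by linarith) hx2.2 p hp
      exact ⟨r, hr⟩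
    · rintro r ⟨u, ⟨C, hu⟩, h0, _, hne, rfl⟩
      exact aux_lower l hl b K hb b1 b2 hbd p hp u C hu h0 hne
  have hupp : ∀ d, 0 < d → x1 + 2 * d ≤ x2 → ∀ p, 0 ≤ p →
      lam1d l b p ≤ 2 * l / d ^ 3 * Real.exp (-p * (b2 - b1 - 2 * K * d)) := by
    intro d hd hd2 p hp
    obtain ⟨r, hr, hle⟩ := aux_upper l hl b K hb hbeven x1 x2 d hd hx1.1 hd2 hx2.2 p hp
    rw [hbx1, hbx2] at hle
    refine le_trans (csInf_le ⟨0, ?_⟩ hr) hle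
    rintro r ⟨u, ⟨C, hu⟩, h0, _, hne, rfl⟩
    exact le_trans (by positivity) (aux_lower l hl b K hb b1 b2 hbd p hp u C hu h0 hne)
  have hlp : ∀ c : ℝ, Filter.Tendsto (fun p : ℝ => c / p) Filter.atTop (nhds 0) :=
    fun c => Filter.Tendsto.div_atTop tendsto_const_nhds Filter.tendsto_id
  have hpos : ∀ p, 0 ≤ p → 0 < lam1d l b p :=
    fun p hp => lt_of_lt_of_le (by positivity) (hlow p hp)
  rw [tendsto_order]
  constructor
  · intro a ha
    obtain ⟨d, hd, hd2, hd3⟩ : ∃ d, 0 < d ∧ x1 + 2 * d ≤ x2 ∧ 2 * K * d < b2 - b1 - a := by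
      refine ⟨min ((x2 - x1) / 2) ((b2 - b1 - a) / (2 * K + 1)),
        lt_min (by linarith) (div_pos (by linarith) (by positivity)), ?_, ?_⟩
      · have := min_le_left ((x2 - x1) / 2) ((b2 - b1 - a) / (2 * K + 1))
        linarith
      · have h1 := min_le_right ((x2 - x1) / 2) ((b2 - b1 - a) / (2 * K + 1))
        have h0 : 0 < (b2 - b1 - a) / (2 * (K:ℝ) + 1) := div_pos (by linarith) (by positivity)
        have h2 := mul_le_mul_of_nonneg_left h1 (by positivity : (0:ℝ) ≤ 2 * K)
        have h3 : (2 * (K:ℝ) + 1) * ((b2 - b1 - a) / (2 * K + 1)) = b2 - b1 - a := by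
          field_simp
        linarith
    have hC : 0 < 2 * l / d ^ 3 := by positivity
    filter_upwards [Filter.eventually_gt_atTop 0, (hlp (Real.log (2 * l / d ^ 3))).eventually
      (gt_mem_nhds (show 0 < b2 - b1 - a - 2 * K * d by linarith))] with p hp hp2
    have h1 := Real.log_le_log (hpos p hp.le) (hupp d hd hd2 p hp.le)
    rw [Real.log_mul hC.ne' (Real.exp_pos _).ne', Real.log_exp] at h1
    rw [one_div (lam1d l b p), Real.log_inv, one_div_mul_eq_div, lt_div_iff₀ hp]
    rw [div_lt_iff₀ hp] at hp2
    linarith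
  · intro a ha
    filter_upwards [Filter.eventually_gt_atTop 0, (hlp (Real.log (4 * l ^ 2))).eventually
      (gt_mem_nhds (show 0 < a - (b2 - b1) by linarith))] with p hp hp2
    have h1 := Real.log_le_log (by positivity) (hlow p hp.le)
    rw [Real.log_inv, Real.log_mul (by positivity) (Real.exp_pos _).ne', Real.log_exp] at h1
    rw [one_div (lam1d l b p), Real.log_inv, one_div_mul_eq_div, div_lt_iff₀ hp]
    rw [div_lt_iff₀ hp] at hp2
    linarith
end

section
/- Let α ≥ 1 and l > 0, and let b(x) := |x|^α / α (so that b'(x) = |x|^α / x, the drift of the paper's model example). Then the variational principal eigenvalue satisfies λ₁(p) · (Γ(1/α + 1) / ((1/α)^{1/α} l^{α−1})) · p^{−(1/α + 1)} · e^{(l^α/α) p} → 1 as p → ∞; that is, λ₁(p) is asymptotically equivalent to ((1/α)^{1/α} l^{α−1} / Γ(1/α + 1)) · p^{1/α + 1} · e^{−(l^α/α) p}. In particular, for α = 2 (the drift a(x) = x), λ₁(p) ∼ √(2/π) · l · p^{3/2} · e^{−(l²/2) p}. -/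
open MeasureTheory intervalIntegral

lemma aux_int_deriv {u : ℝ → ℝ} {K : NNReal} (hu : LipschitzWith K u) {w : ℝ → ℝ}
    (hw : Continuous w) (a b : ℝ) :
    IntervalIntegrable (fun x => w x * deriv u x ^ 2) volume a b := by
  have h1 : IntervalIntegrable (fun x => w x * (K : ℝ) ^ 2) volume a b :=
    (hw.mul continuous_const).intervalIntegrable _ _
  refine h1.mono_fun ?_ ?_
  · exact (hw.aestronglyMeasurable.mul ((measurable_deriv u).pow_const 2).aestronglyMeasurable)
  · refine Filter.Eventually.of_forall fun x => ?_
    have := norm_deriv_le_of_lipschitz (x₀ := x) hu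
    simp only [norm_mul, norm_pow]
    have h2 : ‖(K : ℝ)‖ = K := by simp
    rw [h2]
    gcongr

lemma aux_ftc {u : ℝ → ℝ} {K : NNReal} (hu : LipschitzWith K u) (a b : ℝ) :
    IntervalIntegrable (deriv u) volume a b ∧ ∫ x in a..b, deriv u x = u b - u a := by
  have h : AbsolutelyContinuousOnInterval u a b :=
    (hu.lipschitzOnWith (s := Set.uIcc a b)).absolutelyContinuousOnInterval
  exact ⟨h.intervalIntegrable_deriv, h.integral_deriv_eq_sub⟩

lemma aux_even {f : ℝ → ℝ} (l : ℝ) (hf : ∀ x, f (-x) = f x)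
    (hi : ∀ a b, IntervalIntegrable f volume a b) :
    ∫ x in (-l)..l, f x = 2 * ∫ x in (0:ℝ)..l, f x := by
  rw [← intervalIntegral.integral_add_adjacent_intervals (hi (-l) 0) (hi 0 l)]
  have : ∫ x in (-l)..0, f x = ∫ x in (0:ℝ)..l, f x := by
    have := intervalIntegral.integral_comp_neg (a := 0) (b := l) f
    simp only [hf, neg_zero] at this
    exact this.symm
  rw [this]; ring

/-- Pointwise bound on the half interval. -/
lemma aux_pointwise {u : ℝ → ℝ} {K : NNReal} (hu : LipschitzWith K u) {h : ℝ → ℝ}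
    (hh : Continuous h) {l x : ℝ} (hl : 0 < l) (hx : x ∈ Set.Icc 0 l) (hul : u l = 0) :
    u x ^ 2 ≤ (∫ y in (0:ℝ)..l, Real.exp (-h y) * deriv u y ^ 2) *
      (∫ y in (0:ℝ)..l, Real.exp (h y)) := by
  set M := ∫ y in (0:ℝ)..l, Real.exp (h y) with hM
  set N := ∫ y in (0:ℝ)..l, Real.exp (-h y) * deriv u y ^ 2 with hN
  have hc1 : Continuous fun y => Real.exp (h y) := by fun_prop
  have hc2 : Continuous fun y => Real.exp (-h y) := by fun_prop
  have hMpos : 0 < M := intervalIntegral.intervalIntegral_pos_of_pos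
    (hc1.intervalIntegrable _ _) (fun _ => Real.exp_pos _) hl
  have hMx : ∫ y in x..l, Real.exp (h y) ≤ M := by
    rw [hM]
    exact intervalIntegral.integral_mono_interval hx.1 hx.2 le_rfl
      (Filter.Eventually.of_forall fun y => (Real.exp_pos _).le) (hc1.intervalIntegrable _ _)
  have hNx : ∫ y in x..l, Real.exp (-h y) * deriv u y ^ 2 ≤ N := by
    rw [hN]
    exact intervalIntegral.integral_mono_interval hx.1 hx.2 le_rfl
      (Filter.Eventually.of_forall fun y => mul_nonneg (Real.exp_pos _).le (sq_nonneg _))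
      (aux_int_deriv hu hc2 _ _)
  obtain ⟨hi, hftc⟩ := aux_ftc hu x l
  set t := u x / M with ht
  have key : 0 ≤ ∫ y in x..l, (Real.exp (-h y) * deriv u y ^ 2 + 2 * t * deriv u y
      + t ^ 2 * Real.exp (h y)) := by
    refine intervalIntegral.integral_nonneg hx.2 fun y _ => ?_
    have e1 : Real.exp (-h y) * deriv u y ^ 2 + 2 * t * deriv u y
      + t ^ 2 * Real.exp (h y) = Real.exp (-h y) * (deriv u y + t * Real.exp (h y)) ^ 2 := by
      rw [Real.exp_neg]
      have := Real.exp_pos (h y)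
      field_simp
      ring
    rw [e1]
    exact mul_nonneg (Real.exp_pos _).le (sq_nonneg _)
  rw [intervalIntegral.integral_add ((aux_int_deriv hu hc2 _ _).add (hi.const_mul _))
      ((hc1.intervalIntegrable _ _).const_mul _),
    intervalIntegral.integral_add (aux_int_deriv hu hc2 _ _) (hi.const_mul _),
    intervalIntegral.integral_const_mul, intervalIntegral.integral_const_mul, hftc, hul] at key
  have h3 : t ^ 2 * ∫ y in x..l, Real.exp (h y) ≤ t ^ 2 * M :=
    mul_le_mul_of_nonneg_left hMx (sq_nonneg t)
  have hux : u x = t * M := by rw [ht]; field_simp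
  have h5 : 2 * t * (0 - u x) = -2 * (t ^ 2 * M) := by rw [hux]; ring
  have h4 : 0 ≤ N - t ^ 2 * M := by linarith
  rw [hux]
  nlinarith

lemma aux_half {u : ℝ → ℝ} {K : NNReal} (hu : LipschitzWith K u) {h : ℝ → ℝ}
    (hh : Continuous h) {l : ℝ} (hl : 0 < l) (hul : u l = 0) :
    ∫ y in (0:ℝ)..l, Real.exp (-h y) * u y ^ 2 ≤
    (∫ y in (0:ℝ)..l, Real.exp (-h y)) * ((∫ y in (0:ℝ)..l, Real.exp (-h y) * deriv u y ^ 2) *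
      (∫ y in (0:ℝ)..l, Real.exp (h y))) := by
  have hcu := hu.continuous
  rw [← intervalIntegral.integral_mul_const]
  refine intervalIntegral.integral_mono_on hl.le ?_ ?_ fun x hx => ?_
  · exact Continuous.intervalIntegrable (by fun_prop) _ _
  · exact Continuous.intervalIntegrable (by fun_prop) _ _
  · exact mul_le_mul_of_nonneg_left (aux_pointwise hu hh hl hx hul) (Real.exp_pos _).le

lemma aux_full {u : ℝ → ℝ} {K : NNReal} (hu : LipschitzWith K u) {h : ℝ → ℝ}
    (hh : Continuous h) (he : ∀ x, h (-x) = h x) {l : ℝ} (hl : 0 < l) (hul : u l = 0)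
    (hul' : u (-l) = 0) :
    ∫ y in (-l)..l, Real.exp (-h y) * u y ^ 2 ≤
    (∫ y in (0:ℝ)..l, Real.exp (-h y)) * (∫ y in (0:ℝ)..l, Real.exp (h y)) *
      ∫ y in (-l)..l, Real.exp (-h y) * deriv u y ^ 2 := by
  have hcu := hu.continuous
  have hc2 : Continuous fun y => Real.exp (-h y) := by fun_prop
  have hi : ∀ a b, IntervalIntegrable (fun y => Real.exp (-h y) * u y ^ 2) volume a b :=
    fun a b => Continuous.intervalIntegrable (by fun_prop) _ _
  have hi2 := aux_int_deriv hu hc2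
  have hv : LipschitzWith K (fun x => u (-x)) := by
    intro x y
    have := hu (-x) (-y)
    simpa [edist_neg_neg] using this
  have h1 := aux_half hu hh hl hul
  have h2 := aux_half hv hh hl hul'
  rw [← intervalIntegral.integral_add_adjacent_intervals (hi (-l) 0) (hi 0 l),
    ← intervalIntegral.integral_add_adjacent_intervals (hi2 (-l) 0) (hi2 0 l)]
  have e1 : ∫ y in (-l)..0, Real.exp (-h y) * u y ^ 2 =
      ∫ y in (0:ℝ)..l, Real.exp (-h y) * u (-y) ^ 2 := by
    have := intervalIntegral.integral_comp_neg (a := 0) (b := l)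
      (fun y => Real.exp (-h y) * u y ^ 2)
    simp only [he, neg_zero] at this
    exact this.symm
  have e2 : ∫ y in (-l)..0, Real.exp (-h y) * deriv u y ^ 2 =
      ∫ y in (0:ℝ)..l, Real.exp (-h y) * deriv (fun x => u (-x)) y ^ 2 := by
    have := intervalIntegral.integral_comp_neg (a := 0) (b := l)
      (fun y => Real.exp (-h y) * deriv u y ^ 2)
    simp only [he, neg_zero] at this
    rw [← this]
    refine intervalIntegral.integral_congr fun y _ => ?_
    simp [deriv_comp_neg]
  rw [e1, e2]
  nlinarith

lemma lam_lower {b : ℝ → ℝ} (hb : Continuous b) (he : ∀ x, b (-x) = b x) {l : ℝ} (hl : 0 < l)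
    (p : ℝ) (hne : { r | ∃ u : ℝ → ℝ, (∃ K, LipschitzWith K u) ∧ u (-l) = 0 ∧ u l = 0 ∧
    (∃ x ∈ Set.Icc (-l) l, u x ≠ 0) ∧
    r = (∫ x in (-l)..l, Real.exp (-p * b x) * deriv u x ^ 2) /
        (∫ x in (-l)..l, Real.exp (-p * b x) * u x ^ 2) }.Nonempty) :
    1 / ((∫ y in (0:ℝ)..l, Real.exp (-p * b y)) * (∫ y in (0:ℝ)..l, Real.exp (p * b y)))
      ≤ lam1d l b p := by
  have hpos1 : 0 < ∫ y in (0:ℝ)..l, Real.exp (-p * b y) :=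
    intervalIntegral.intervalIntegral_pos_of_pos
      (Continuous.intervalIntegrable (by fun_prop) _ _) (fun _ => Real.exp_pos _) hl
  have hpos2 : 0 < ∫ y in (0:ℝ)..l, Real.exp (p * b y) :=
    intervalIntegral.intervalIntegral_pos_of_pos
      (Continuous.intervalIntegrable (by fun_prop) _ _) (fun _ => Real.exp_pos _) hl
  refine le_csInf hne ?_
  rintro r ⟨u, ⟨K, hu⟩, h1, h2, ⟨x, hx, hux⟩, rfl⟩
  have hcu := hu.continuous
  have hD : 0 < ∫ x in (-l)..l, Real.exp (-p * b x) * u x ^ 2 := by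
    refine intervalIntegral.integral_pos (by linarith) (Continuous.continuousOn (by fun_prop))
      (fun y _ => mul_nonneg (Real.exp_pos _).le (sq_nonneg _)) ⟨x, hx, ?_⟩
    have := Real.exp_pos (-p * b x)
    positivity
  have h3 := aux_full hu (h := fun x => p * b x) (by fun_prop) (by simp [he]) hl h2 h1
  simp only [← neg_mul] at h3
  rw [div_le_div_iff₀ (mul_pos hpos1 hpos2) hD]
  linarith

lemma lam_upper {b : ℝ → ℝ} (hb : Continuous b) (he : ∀ x, b (-x) = b x)
    (hm : MonotoneOn b (Set.Ici 0)) {l : ℝ} (hl : 0 < l)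
    {p : ℝ} (hp : 0 ≤ p) :
    ∃ r ∈ { r | ∃ u : ℝ → ℝ, (∃ K, LipschitzWith K u) ∧ u (-l) = 0 ∧ u l = 0 ∧
    (∃ x ∈ Set.Icc (-l) l, u x ≠ 0) ∧
    r = (∫ x in (-l)..l, Real.exp (-p * b x) * deriv u x ^ 2) /
        (∫ x in (-l)..l, Real.exp (-p * b x) * u x ^ 2) },
    (2 * l ^ 2 <
      (∫ y in (0:ℝ)..l, Real.exp (-p * b y)) * (∫ y in (0:ℝ)..l, Real.exp (p * b y)) →
    r ≤ 1 / ((∫ y in (0:ℝ)..l, Real.exp (-p * b y)) * (∫ y in (0:ℝ)..l, Real.exp (p * b y))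
      - 2 * l ^ 2)) := by
  set W := ∫ y in (0:ℝ)..l, Real.exp (-p * b y) with hW
  set M := ∫ y in (0:ℝ)..l, Real.exp (p * b y) with hM
  have hMpos : 0 < M :=
    intervalIntegral.intervalIntegral_pos_of_pos
      (Continuous.intervalIntegrable (by fun_prop) _ _) (fun _ => Real.exp_pos _) hl
  set G : ℝ → ℝ := fun y => Real.exp (p * b (min |y| l)) with hG
  have hGc : Continuous G := by fun_prop
  have hGe : ∀ x, G (-x) = G x := fun x => by simp [hG]
  have hGpos : ∀ x, 0 < G x := fun x => Real.exp_pos _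
  have hGabs : ∀ x ∈ Set.Icc (-l) l, G x = Real.exp (p * b x) := by
    intro x hx
    have h1 : |x| ≤ l := abs_le.2 hx
    simp only [hG, min_eq_left h1]
    rcases abs_choice x with h | h <;> rw [h]
    rw [he]
  set F : ℝ → ℝ := fun x => ∫ y in (0:ℝ)..x, G y with hF
  have hFd : ∀ x, HasDerivAt F (G x) x := fun x => hGc.integral_hasStrictDerivAt 0 x |>.hasDerivAt
  have hFl : F l = M := by
    refine intervalIntegral.integral_congr fun y hy => ?_
    rw [Set.uIcc_of_le hl.le] at hy
    exact hGabs y ⟨by linarith [hy.1], hy.2⟩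
  set C : NNReal := ⟨Real.exp (p * b l), (Real.exp_pos _).le⟩ with hC
  have hFLip : LipschitzWith C F := by
    refine lipschitzWith_of_nnnorm_deriv_le (fun x => (hFd x).differentiableAt) fun x => ?_
    rw [(hFd x).deriv, ← NNReal.coe_le_coe, coe_nnnorm, Real.norm_of_nonneg (hGpos x).le]
    refine Real.exp_le_exp.2 (mul_le_mul_of_nonneg_left (hm ?_ ?_ (min_le_right _ _)) hp)
    · exact le_min (abs_nonneg _) hl.le
    · exact hl.le
  have hFodd : ∀ x, F (-x) = - F x := by
    intro x
    have := intervalIntegral.integral_comp_neg (a := 0) (b := x) G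
    simp only [hGe, neg_zero] at this
    simp only [hF]
    rw [this, intervalIntegral.integral_symm]
  set u : ℝ → ℝ := fun x => M - F |x| with hu
  have huLip : LipschitzWith (C * 1) u := by
    have h1 : LipschitzWith (C * 1) (fun x : ℝ => F |x|) :=
      hFLip.comp (by simpa using! lipschitzWith_one_norm (E := ℝ))
    intro x y
    simp only [hu, edist_sub_left]
    exact h1 x y
  have huc := huLip.continuous
  have hue : ∀ x, u (-x) = u x := fun x => by simp [hu]
  have hud : ∀ x, x ≠ 0 → deriv u x ^ 2 = G x ^ 2 := by
    intro x hx
    rcases lt_or_gt_of_ne hx with h | h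
    · have h1 : u =ᶠ[nhds x] fun y => M + F y := by
        filter_upwards [Iio_mem_nhds h] with y hy
        simp only [hu, abs_of_neg (Set.mem_Iio.1 hy), hFodd]; ring
      rw [h1.deriv_eq, ((hFd x).const_add M).deriv]
    · have h1 : u =ᶠ[nhds x] fun y => M - F y := by
        filter_upwards [Ioi_mem_nhds h] with y hy
        simp only [hu, abs_of_pos (Set.mem_Ioi.1 hy)]
      rw [h1.deriv_eq, ((hFd x).const_sub M).deriv]; ring
  have hN : ∫ x in (-l)..l, Real.exp (-p * b x) * deriv u x ^ 2 = 2 * M := by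
    have h1 : ∫ x in (-l)..l, Real.exp (-p * b x) * deriv u x ^ 2 =
        ∫ x in (-l)..l, Real.exp (p * b x) := by
      refine intervalIntegral.integral_congr_ae ?_
      have h0 : ∀ᵐ x : ℝ, x ≠ 0 := by simp [ae_iff]
      filter_upwards [h0] with x hx hx'
      rw [Set.uIoc_of_le (by linarith)] at hx'
      rw [hud x hx, hGabs x ⟨hx'.1.le, hx'.2⟩, ← Real.exp_nat_mul, ← Real.exp_add]
      congr 1
      push_cast; ring
    rw [h1, aux_even l (by simp [he])
      (fun _ _ => Continuous.intervalIntegrable (by fun_prop) _ _)]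
  have hFnn : ∀ x ∈ Set.Icc 0 l, Real.exp (-p * b x) * F x ≤ l := by
    intro x hx
    have h1 : F x ≤ ∫ y in (0:ℝ)..x, Real.exp (p * b x) := by
      refine intervalIntegral.integral_mono_on hx.1 (hGc.intervalIntegrable _ _)
        (continuous_const.intervalIntegrable _ _) fun y hy => ?_
      rw [hGabs y ⟨by linarith [hy.1], hy.2.trans hx.2⟩]
      exact Real.exp_le_exp.2 (mul_le_mul_of_nonneg_left (hm hy.1 hx.1 hy.2) hp)
    simp only [intervalIntegral.integral_const, sub_zero, smul_eq_mul] at h1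
    calc Real.exp (-p * b x) * F x ≤ Real.exp (-p * b x) * (x * Real.exp (p * b x)) :=
          mul_le_mul_of_nonneg_left h1 (Real.exp_pos _).le
      _ = x * (Real.exp (-p * b x) * Real.exp (p * b x)) := by ring
      _ = x := by rw [← Real.exp_add]; simp
      _ ≤ l := hx.2
  have hD : 2 * (M ^ 2 * W - 2 * M * l ^ 2) ≤ ∫ x in (-l)..l, Real.exp (-p * b x) * u x ^ 2 := by
    rw [aux_even l (by simp [he, hue])
      (fun _ _ => Continuous.intervalIntegrable (by fun_prop) _ _)]
    refine mul_le_mul_of_nonneg_left ?_ zero_le_two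
    have e : M ^ 2 * W - 2 * M * l ^ 2 =
        ∫ x in (0:ℝ)..l, (M ^ 2 * Real.exp (-p * b x) - 2 * M * l) := by
      rw [intervalIntegral.integral_sub (Continuous.intervalIntegrable (by fun_prop) _ _)
        (Continuous.intervalIntegrable (by fun_prop) _ _), intervalIntegral.integral_const_mul,
        intervalIntegral.integral_const, smul_eq_mul]
      ring
    rw [e]
    refine intervalIntegral.integral_mono_on hl.le (Continuous.intervalIntegrable (by fun_prop) _ _)
        (Continuous.intervalIntegrable (by fun_prop) _ _) fun x hx => ?_
    have h1 := hFnn x hx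
    simp only [hu, abs_of_nonneg hx.1]
    have h2 : 0 ≤ Real.exp (-p * b x) * F x ^ 2 := mul_nonneg (Real.exp_pos _).le (sq_nonneg _)
    have h3 := mul_le_mul_of_nonneg_left h1 (by positivity : 0 ≤ 2 * M)
    nlinarith
  refine ⟨_, ⟨u, ⟨_, huLip⟩, ?_, ?_, ⟨0, ⟨by linarith, hl.le⟩, ?_⟩, rfl⟩, fun hMW => ?_⟩
  · simp [hu, abs_of_pos hl, hFl]
  · simp [hu, abs_of_pos hl, hFl]
  · simp [hu, hF, hMpos.ne']
  · rw [hN]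
    have h1 : 0 < W * M - 2 * l ^ 2 := by linarith
    have h2 : 0 < 2 * (M ^ 2 * W - 2 * M * l ^ 2) := by
      have := mul_pos hMpos h1
      nlinarith
    rw [div_le_div_iff₀ (h2.trans_le hD) h1]
    nlinarith

lemma W_asym {α l : ℝ} (hα : 1 ≤ α) (hl : 0 < l) :
    Filter.Tendsto (fun p : ℝ => p ^ (1 / α) * ∫ x in (0:ℝ)..l, Real.exp (-p * (|x| ^ α / α)))
      Filter.atTop (nhds ((1 / α) ^ (-1 / α) * Real.Gamma (1 / α + 1))) := by
  have hα0 : 0 < α := by linarith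
  rw [← integral_exp_neg_mul_rpow hα0 (by positivity : 0 < 1 / α)]
  have hint : IntegrableOn (fun x : ℝ => Real.exp (-(1 / α) * x ^ α)) (Set.Ioi 0) := by
    have := integrableOn_rpow_mul_exp_neg_mul_rpow (s := 0) (p := α) (b := 1 / α)
      (by norm_num) hα0 (by positivity)
    simpa using this
  have hb : Filter.Tendsto (fun p : ℝ => p ^ (1 / α) * l) Filter.atTop Filter.atTop :=
    (tendsto_rpow_atTop (by positivity)).atTop_mul_const hl
  refine (intervalIntegral_tendsto_integral_Ioi 0 hint hb).congr' ?_
  filter_upwards [Filter.eventually_gt_atTop 0] with p hp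
  have hq : 0 < p ^ (1 / α) := Real.rpow_pos_of_pos hp _
  have := intervalIntegral.smul_integral_comp_mul_left (a := 0) (b := l)
    (fun x : ℝ => Real.exp (-(1 / α) * x ^ α)) (p ^ (1 / α))
  simp only [mul_zero, smul_eq_mul] at this
  rw [← this]
  congr 1
  refine intervalIntegral.integral_congr fun x hx => ?_
  rw [Set.uIcc_of_le hl.le] at hx
  show Real.exp (-(1 / α) * (p ^ (1 / α) * x) ^ α) = Real.exp (-p * (|x| ^ α / α))
  rw [abs_of_nonneg hx.1, Real.mul_rpow hq.le hx.1, ← Real.rpow_mul hp.le,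
    one_div_mul_cancel hα0.ne', Real.rpow_one]
  congr 1
  ring

lemma M_asym {α l : ℝ} (hα : 1 ≤ α) (hl : 0 < l) :
    Filter.Tendsto (fun p : ℝ => p * Real.exp (-(l ^ α / α) * p) *
        ∫ x in (0:ℝ)..l, Real.exp (p * (|x| ^ α / α)))
      Filter.atTop (nhds (1 / l ^ (α - 1))) := by
  have hα0 : 0 < α := by linarith
  set c := l ^ (α - 1) with hc
  have hcpos : 0 < c := Real.rpow_pos_of_pos hl _
  have hlc : l ^ α = c * l := by
    rw [hc, ← Real.rpow_add_one hl.ne']; congr 1; ring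
  have hlim : ∫ t in Set.Ioi (0:ℝ), Real.exp (-c * t) = 1 / c := by
    rw [integral_exp_mul_Ioi (by linarith)]
    simp [neg_div_neg_eq]
  rw [← hlim]
  set f : ℝ → ℝ → ℝ := fun p t =>
    Real.exp (p * (|l - t / p| ^ α / α) - l ^ α / α * p) with hf
  have hfc : ∀ p, Continuous (f p) := by
    intro p
    have : Continuous fun t : ℝ => |l - t / p| ^ α :=
      Continuous.rpow_const (by fun_prop) (fun _ => Or.inr hα0.le)
    fun_prop
  have hbint : IntegrableOn (fun t => Real.exp (-(c / α) * t)) (Set.Ioi 0) :=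
    integrableOn_exp_mul_Ioi (by have := div_pos hcpos hα0; linarith) 0
  have main : Filter.Tendsto (fun p : ℝ => ∫ t in Set.Ioi (0:ℝ),
      (Set.Ioc 0 (l * p)).indicator (f p) t) Filter.atTop
      (nhds (∫ t in Set.Ioi (0:ℝ), Real.exp (-c * t))) := by
    refine MeasureTheory.tendsto_integral_filter_of_dominated_convergence
      (fun t => Real.exp (-(c / α) * t)) ?_ ?_ hbint ?_
    · exact Filter.Eventually.of_forall fun p =>
        ((hfc p).measurable.indicator measurableSet_Ioc).aestronglyMeasurable
    · filter_upwards [Filter.eventually_gt_atTop 0] with p hp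
      refine Filter.Eventually.of_forall fun t => ?_
      by_cases ht : t ∈ Set.Ioc 0 (l * p)
      · rw [Set.indicator_of_mem ht, Real.norm_of_nonneg (Real.exp_pos _).le]
        refine Real.exp_le_exp.2 ?_
        have h1 : 0 ≤ 1 - t / (l * p) := by
          rw [sub_nonneg, div_le_one (by positivity)]; exact ht.2
        have h2 : l - t / p = l * (1 - t / (l * p)) := by field_simp
        have h3 : 1 - t / (l * p) ≤ 1 := by
          have : 0 ≤ t / (l * p) := div_nonneg ht.1.le (by positivity)
          linarith
        have h4 : (1 - t / (l * p)) ^ α ≤ 1 - t / (l * p) := by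
          simpa using Real.rpow_le_rpow_of_exponent_ge' h1 h3 zero_le_one hα
        rw [h2, abs_of_nonneg (by positivity), Real.mul_rpow hl.le h1, hlc]
        have h5 : p * (c * l * (1 - t / (l * p)) / α) - c * l / α * p = -(c / α) * t := by
          field_simp; ring
        rw [← h5]
        gcongr
      · rw [Set.indicator_of_notMem ht, norm_zero]
        exact (Real.exp_pos _).le
    · refine (ae_restrict_mem measurableSet_Ioi).mono fun t ht => ?_
      have ht : 0 < t := ht
      have hd : HasDerivAt (fun s : ℝ => (l - t * s) ^ α / α) (-c * t) 0 := by
        have h1 : HasDerivAt (fun s : ℝ => l - t * s) (-t) 0 := by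
          simpa using ((hasDerivAt_id (0:ℝ)).const_mul t).const_sub l
        have h2 := (h1.rpow_const (p := α) (Or.inr hα)).div_const α
        convert! h2 using 1
        simp only [mul_zero, sub_zero, hc]
        field_simp
      have h1 := (hasDerivAt_iff_tendsto_slope_zero.1 hd).mono_left
        (nhdsWithin_mono (0:ℝ) (fun x (hx : 0 < x) => ne_of_gt hx))
      have h2 := (Real.continuous_exp.tendsto _).comp
        (h1.comp (tendsto_inv_atTop_nhdsGT_zero (𝕜 := ℝ)))
      refine h2.congr' ?_
      filter_upwards [Filter.eventually_gt_atTop 0, Filter.eventually_ge_atTop (t / l)] with p hp hp2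
      have hm : t ∈ Set.Ioc 0 (l * p) := ⟨ht, by rw [div_le_iff₀ hl] at hp2; linarith⟩
      rw [Set.indicator_of_mem hm]
      have h3 : 0 ≤ l - t / p := by
        rw [sub_nonneg, div_le_iff₀ hp]; exact hm.2
      simp only [hf]
      rw [abs_of_nonneg h3]
      simp only [Function.comp, smul_eq_mul, zero_add, mul_zero, sub_zero,
        inv_inv, div_eq_mul_inv]
      congr 1
      ring
  refine main.congr' ?_
  filter_upwards [Filter.eventually_gt_atTop 0] with p hp
  rw [MeasureTheory.setIntegral_indicator measurableSet_Ioc,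
    Set.inter_eq_right.2 (fun x hx => hx.1),
    ← intervalIntegral.integral_of_le (by positivity)]
  have := intervalIntegral.integral_comp_sub_div (a := 0) (b := l * p)
    (fun x : ℝ => Real.exp (p * (|x| ^ α / α) - l ^ α / α * p)) hp.ne' l
  simp only [hf]
  rw [this]
  simp only [mul_div_cancel_right₀ _ hp.ne', sub_self, zero_div, sub_zero, smul_eq_mul]
  rw [mul_assoc, ← intervalIntegral.integral_const_mul (Real.exp (-(l ^ α / α) * p))]
  congr 1
  refine intervalIntegral.integral_congr fun x _ => ?_
  simp only [← Real.exp_add]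
  congr 1
  ring

theorem principal_eigenvalue_asymptotics_power_drift (α l : ℝ) (hα : 1 ≤ α) (hl : 0 < l) :
    Filter.Tendsto
      (fun p : ℝ => lam1d l (fun x => |x| ^ α / α) p *
        (Real.Gamma (1 / α + 1) / ((1 / α) ^ (1 / α) * l ^ (α - 1))) *
        p ^ (-(1 / α + 1)) * Real.exp ((l ^ α / α) * p))
      Filter.atTop (nhds 1) := by
  have hα0 : 0 < α := by linarith
  have hb : Continuous fun x : ℝ => |x| ^ α / α :=
    (Continuous.rpow_const (by fun_prop) (fun _ => Or.inr hα0.le)).div_const α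
  have he : ∀ x : ℝ, |(-x)| ^ α / α = |x| ^ α / α := by simp
  have hm : MonotoneOn (fun x : ℝ => |x| ^ α / α) (Set.Ici 0) := by
    intro x hx y hy hxy
    have hx : 0 ≤ x := hx
    have hy : 0 ≤ y := hy
    simp only [abs_of_nonneg hx, abs_of_nonneg hy]
    gcongr
  set W : ℝ → ℝ := fun p => ∫ x in (0:ℝ)..l, Real.exp (-p * (|x| ^ α / α)) with hW
  set M : ℝ → ℝ := fun p => ∫ x in (0:ℝ)..l, Real.exp (p * (|x| ^ α / α)) with hM
  set κ := Real.Gamma (1 / α + 1) / ((1 / α) ^ (1 / α) * l ^ (α - 1)) with hκ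
  have hΓ : 0 < Real.Gamma (1 / α + 1) := Real.Gamma_pos_of_pos (by positivity)
  have hκpos : 0 < κ := by positivity
  set R : ℝ → ℝ := fun p => p ^ (1 / α + 1) * Real.exp (-(l ^ α / α) * p) with hR
  have hWM : Filter.Tendsto (fun p => R p * (W p * M p)) Filter.atTop (nhds κ) := by
    have h := (W_asym hα hl).mul (M_asym hα hl)
    have e : (1 / α) ^ (-1 / α) * Real.Gamma (1 / α + 1) * (1 / l ^ (α - 1)) = κ := by
      rw [hκ, neg_div, Real.rpow_neg (by positivity)]
      field_simp
    rw [e] at h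
    refine h.congr' ?_
    filter_upwards [Filter.eventually_gt_atTop 0] with p hp
    simp only [hR, hW, hM, Real.rpow_add_one hp.ne']
    ring
  have hR0 : Filter.Tendsto R Filter.atTop (nhds 0) :=
    tendsto_rpow_mul_exp_neg_mul_atTop_nhds_zero _ _ (by positivity)
  have hWM2 : Filter.Tendsto (fun p => R p * (W p * M p - 2 * l ^ 2)) Filter.atTop (nhds κ) := by
    have := hWM.sub (hR0.mul_const (2 * l ^ 2))
    simp only [zero_mul, sub_zero] at this
    refine this.congr fun p => ?_
    ring
  have hlow : Filter.Tendsto (fun p => κ / (R p * (W p * M p))) Filter.atTop (nhds 1) := by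
    have := (tendsto_const_nhds (x := κ)).div hWM hκpos.ne'
    rwa [div_self hκpos.ne'] at this
  have hup : Filter.Tendsto (fun p => κ / (R p * (W p * M p - 2 * l ^ 2))) Filter.atTop
      (nhds 1) := by
    have := (tendsto_const_nhds (x := κ)).div hWM2 hκpos.ne'
    rwa [div_self hκpos.ne'] at this
  have hform : ∀ p, 0 < p → ∀ L : ℝ, L * κ * p ^ (-(1 / α + 1)) * Real.exp ((l ^ α / α) * p)
      = L * (κ / R p) := by
    intro p hp L
    simp only [hR, Real.rpow_neg hp.le, neg_mul, Real.exp_neg]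
    have := Real.exp_pos (l ^ α / α * p)
    have := Real.rpow_pos_of_pos hp (1 / α + 1)
    field_simp
  have hRpos : ∀ p, 0 < p → 0 < R p := fun p hp =>
    mul_pos (Real.rpow_pos_of_pos hp _) (Real.exp_pos _)
  refine tendsto_of_tendsto_of_tendsto_of_le_of_le' hlow hup ?_ ?_
  · filter_upwards [Filter.eventually_gt_atTop 0] with p hp
    rw [hform p hp]
    obtain ⟨r, hr, -⟩ := lam_upper hb he hm hl hp.le
    have h1 := lam_lower hb he hl p ⟨r, hr⟩
    have h2 := mul_le_mul_of_nonneg_right h1 (div_pos hκpos (hRpos p hp)).le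
    refine le_trans (le_of_eq ?_) h2
    rw [one_div_mul_eq_div, div_div (κ)]
  · filter_upwards [Filter.eventually_gt_atTop 0, hWM2.eventually (lt_mem_nhds hκpos)] with p hp hp2
    rw [hform p hp]
    obtain ⟨r, hr, hr2⟩ := lam_upper hb he hm hl hp.le
    have h3 : 0 < W p * M p - 2 * l ^ 2 := (mul_pos_iff_of_pos_left (hRpos p hp)).1 hp2
    have h1 := hr2 (by simpa only [sub_pos] using h3)
    have hbdd : lam1d l (fun x => |x| ^ α / α) p ≤ r := by
      refine csInf_le ⟨0, ?_⟩ hr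
      rintro s ⟨u, -, -, -, -, rfl⟩
      exact div_nonneg
        (intervalIntegral.integral_nonneg (by linarith)
          fun x _ => mul_nonneg (Real.exp_pos _).le (sq_nonneg _))
        (intervalIntegral.integral_nonneg (by linarith)
          fun x _ => mul_nonneg (Real.exp_pos _).le (sq_nonneg _))
    have h2 := mul_le_mul_of_nonneg_right (hbdd.trans h1) (div_pos hκpos (hRpos p hp)).le
    refine h2.trans (le_of_eq ?_)
    rw [one_div_mul_eq_div, div_div (κ)]
end

section
/- Let l > √2 and let b(x) := (x² − 1)²/4 (so that b'(x) = x³ − x, the double-well drift). Then the variational principal eigenvalue satisfies λ₁(p) · (√π / (l³ − l)) · p^{−3/2} · e^{p (l²−1)²/4} → 1 as p → ∞; that is, λ₁(p) is asymptotically equivalent to ((l³ − l)/√π) · p^{3/2} · e^{−p(l²−1)²/4}. -/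
open MeasureTheory intervalIntegral

lemma ii_deriv {w u : ℝ → ℝ} (hw : Continuous w) {K : NNReal} (hu : LipschitzWith K u) (n : ℕ)
    (a b : ℝ) : IntervalIntegrable (fun x => w x * deriv u x ^ n) volume a b := by
  have h1 : IntervalIntegrable (fun x => |w x| * (K:ℝ) ^ n) volume a b :=
    (by fun_prop : Continuous (fun x => |w x| * (K:ℝ) ^ n)).intervalIntegrable _ _
  refine h1.mono_fun ?_ ?_
  · exact (hw.measurable.mul ((measurable_deriv u).pow_const n)).aestronglyMeasurable
  · refine Filter.Eventually.of_forall fun x => ?_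
    have h := norm_deriv_le_of_lipschitz (x₀ := x) hu
    simp only [norm_mul, norm_pow, Real.norm_eq_abs, abs_abs] at *
    rw [abs_of_nonneg (NNReal.coe_nonneg K)]
    gcongr

lemma hardy_pt {l : ℝ} {w : ℝ → ℝ} (hw : Continuous w) (hp : ∀ x, 0 < w x)
    {u : ℝ → ℝ} {K : NNReal} (hu : LipschitzWith K u) (hul : u l = 0) {x : ℝ} (hx : x ∈ Set.Icc 0 l) :
    u x ^ 2 ≤ (∫ t in (0:ℝ)..l, (w t)⁻¹) * ∫ t in (0:ℝ)..l, w t * deriv u t ^ 2 := by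
  have hwi : Continuous (fun t => (w t)⁻¹) := hw.inv₀ fun t => (hp t).ne'
  have i1 : ∀ a b, IntervalIntegrable (fun t => (w t)⁻¹) volume a b :=
    fun a b => hwi.intervalIntegrable _ _
  have i2 := ii_deriv hw hu 2
  have i3 : ∀ a b, IntervalIntegrable (fun t => deriv u t) volume a b := by
    intro a b
    simpa using ii_deriv (w := fun _ => 1) (by fun_prop) hu 1 a b
  have hm : ∫ t in x..l, deriv u t = - u x := by
    rw [(hu.lipschitzOnWith (s := Set.uIcc x l)).absolutelyContinuousOnInterval.integral_deriv_eq_sub,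
      hul, zero_sub]
  have hq : ∀ s : ℝ, 0 ≤ (∫ t in x..l, (w t)⁻¹) * (s * s) + (-2 * u x) * s
      + ∫ t in x..l, w t * deriv u t ^ 2 := by
    intro s
    have e : (∫ t in x..l, (w t)⁻¹) * (s * s) + (-2 * u x) * s
      + ∫ t in x..l, w t * deriv u t ^ 2
      = ∫ t in x..l, ((w t)⁻¹ * (s * s) + deriv u t * (2 * s) + w t * deriv u t ^ 2) := by
      rw [integral_add (((i1 _ _).mul_const _).add ((i3 _ _).mul_const _)) (i2 _ _),
        integral_add ((i1 _ _).mul_const _) ((i3 _ _).mul_const _),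
        intervalIntegral.integral_mul_const, intervalIntegral.integral_mul_const, hm]
      ring
    rw [e]
    refine integral_nonneg hx.2 fun t _ => ?_
    have : (w t)⁻¹ * (s * s) + deriv u t * (2 * s) + w t * deriv u t ^ 2
      = (w t)⁻¹ * (s + w t * deriv u t) ^ 2 := by
      have := (hp t).ne'
      field_simp
      ring
    rw [this]
    have := hp t
    positivity
  have hd := discrim_le_zero hq
  unfold discrim at hd
  have m1 : ∫ t in x..l, (w t)⁻¹ ≤ ∫ t in (0:ℝ)..l, (w t)⁻¹ := by
    refine integral_mono_interval hx.1 hx.2 le_rfl ?_ (i1 _ _)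
    exact Filter.Eventually.of_forall fun t => (inv_pos.2 (hp t)).le
  have m2 : ∫ t in x..l, w t * deriv u t ^ 2 ≤ ∫ t in (0:ℝ)..l, w t * deriv u t ^ 2 := by
    refine integral_mono_interval hx.1 hx.2 le_rfl ?_ (i2 _ _)
    exact Filter.Eventually.of_forall fun t => mul_nonneg (hp t).le (sq_nonneg _)
  have n1 : 0 ≤ ∫ t in (0:ℝ)..l, (w t)⁻¹ :=
    integral_nonneg (hx.1.trans hx.2) fun t _ => (inv_pos.2 (hp t)).le
  have n2 : 0 ≤ ∫ t in x..l, w t * deriv u t ^ 2 :=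
    integral_nonneg hx.2 fun t _ => mul_nonneg (hp t).le (sq_nonneg _)
  calc u x ^ 2 ≤ (∫ t in x..l, (w t)⁻¹) * ∫ t in x..l, w t * deriv u t ^ 2 := by nlinarith
    _ ≤ _ := by gcongr

lemma hardy_half {l : ℝ} (hl : 0 < l) {w : ℝ → ℝ} (hw : Continuous w) (hp : ∀ x, 0 < w x)
    {u : ℝ → ℝ} {K : NNReal} (hu : LipschitzWith K u) (hul : u l = 0) :
    ∫ t in (0:ℝ)..l, w t * u t ^ 2 ≤ (∫ t in (0:ℝ)..l, w t) * (∫ t in (0:ℝ)..l, (w t)⁻¹) *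
      ∫ t in (0:ℝ)..l, w t * deriv u t ^ 2 := by
  have hc := hu.continuous
  rw [mul_assoc, ← intervalIntegral.integral_mul_const]
  refine integral_mono_on hl.le (Continuous.intervalIntegrable (by fun_prop) _ _)
    (Continuous.intervalIntegrable (by fun_prop) _ _) fun t ht => ?_
  exact mul_le_mul_of_nonneg_left (hardy_pt hw hp hu hul ht) (hp t).le

lemma hardy_full {l : ℝ} (hl : 0 < l) {w : ℝ → ℝ} (hw : Continuous w) (hp : ∀ x, 0 < w x)
    (he : ∀ x, w (-x) = w x)
    {u : ℝ → ℝ} {K : NNReal} (hu : LipschitzWith K u) (hul : u l = 0) (hul' : u (-l) = 0) :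
    ∫ t in (-l)..l, w t * u t ^ 2 ≤ (∫ t in (0:ℝ)..l, w t) * (∫ t in (0:ℝ)..l, (w t)⁻¹) *
      ∫ t in (-l)..l, w t * deriv u t ^ 2 := by
  have hc := hu.continuous
  have hv : LipschitzWith K (fun x => u (-x)) := by
    have := hu.comp (LipschitzWith.id.neg : LipschitzWith 1 (fun x : ℝ => -x))
    simpa [Function.comp_def] using this
  have h1 := hardy_half hl hw hp hu hul
  have h2 := hardy_half hl hw hp hv hul'
  have e1 : ∫ t in (0:ℝ)..l, w t * u (-t) ^ 2 = ∫ t in (-l)..0, w t * u t ^ 2 := by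
    have := intervalIntegral.integral_comp_neg (a := 0) (b := l) (fun t => w t * u t ^ 2)
    simpa [he] using this
  have e2 : ∫ t in (0:ℝ)..l, w t * deriv (fun x => u (-x)) t ^ 2
      = ∫ t in (-l)..0, w t * deriv u t ^ 2 := by
    have := intervalIntegral.integral_comp_neg (a := 0) (b := l) (fun t => w t * deriv u t ^ 2)
    simpa [he, deriv_comp_neg] using this
  rw [e1, e2] at h2
  rw [← integral_add_adjacent_intervals (b := 0) (ii_deriv hw hu 2 _ _) (ii_deriv hw hu 2 _ _),
    ← integral_add_adjacent_intervals (b := 0) (f := fun t => w t * u t ^ 2)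
      (Continuous.intervalIntegrable (by fun_prop) _ _)
      (Continuous.intervalIntegrable (by fun_prop) _ _)]
  linarith

lemma test_fun {l c : ℝ} (hc : 0 < c) (hcl : c < l) {w : ℝ → ℝ} (hw : Continuous w)
    (hp : ∀ x, 0 < w x) (he : ∀ x, w (-x) = w x) :
    ∃ u : ℝ → ℝ, (∃ K, LipschitzWith K u) ∧ u (-l) = 0 ∧ u l = 0 ∧
      (∃ x ∈ Set.Icc (-l) l, u x ≠ 0) ∧
      (∫ x in (-l)..l, w x * deriv u x ^ 2) = 2 * ∫ t in c..l, (w t)⁻¹ ∧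
      2 * (∫ t in (0:ℝ)..c, w t) * (∫ t in c..l, (w t)⁻¹) ^ 2 ≤ ∫ x in (-l)..l, w x * u x ^ 2 := by
  have hwi : Continuous (fun t => (w t)⁻¹) := hw.inv₀ fun t => (hp t).ne'
  set κ : ℝ → ℝ := fun x => max (min |x| l) c with hκ
  have hκc : Continuous κ := by fun_prop
  have hκm : ∀ x, κ x ∈ Set.Icc c l := fun x => ⟨le_max_right _ _, max_le (min_le_right _ _) hcl.le⟩
  have hκL : LipschitzWith 1 κ := by
    have h0 : LipschitzWith 1 (fun x : ℝ => |x|) := lipschitzWith_one_norm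
    exact (h0.min_const l).max_const c
  have hκl : ∀ x ∈ Set.Icc c l, κ x = x := fun x hx => by
    have : 0 ≤ x := hc.le.trans hx.1
    simp [hκ, abs_of_nonneg this, hx.1, hx.2]
  have hκe : ∀ x, κ (-x) = κ x := fun x => by simp [hκ]
  set g : ℝ → ℝ := fun t => (w (κ t))⁻¹ with hg
  have hgc : Continuous g := hwi.comp hκc
  have hgp : ∀ t, 0 < g t := fun t => inv_pos.2 (hp _)
  obtain ⟨M, hM⟩ := (isCompact_Icc (a := c) (b := l)).exists_bound_of_continuousOn hwi.continuousOn
  set F : ℝ → ℝ := fun y => ∫ t in y..l, g t with hF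
  have hFd : ∀ y, HasDerivAt F (-g y) y := fun y =>
    integral_hasDerivAt_left (hgc.intervalIntegrable _ _) (hgc.stronglyMeasurableAtFilter _ _)
      hgc.continuousAt
  have hFL : LipschitzWith M.toNNReal F := by
    refine lipschitzWith_of_nnnorm_deriv_le (fun y => (hFd y).differentiableAt) fun y => ?_
    rw [(hFd y).deriv, nnnorm_neg]
    have := hM (κ y) (hκm y)
    exact NNReal.le_toNNReal_of_coe_le this
  have hgw : ∫ t in c..l, g t = ∫ t in c..l, (w t)⁻¹ := by
    refine integral_congr fun t ht => ?_
    rw [Set.uIcc_of_le hcl.le] at ht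
    simp [hg, hκl t ht]
  set u : ℝ → ℝ := fun x => F (κ x) with hu
  have huL : LipschitzWith (M.toNNReal * 1) u := hFL.comp hκL
  have huc := huL.continuous
  have hl0 : 0 < l := hc.trans hcl
  have hul : u l = 0 := by simp [hu, hκl l ⟨hcl.le, le_rfl⟩, hF]
  have hue : ∀ x, u (-x) = u x := fun x => by simp [hu, hκe]
  have hu0 : ∀ x ∈ Set.Icc 0 c, u x = ∫ t in c..l, (w t)⁻¹ := fun x hx => by
    have : κ x = c := by
      simp only [hκ, abs_of_nonneg hx.1]
      exact max_eq_right ((min_le_left _ _).trans hx.2)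
    simp only [hu, this, hF, hgw]
  have hA : 0 < ∫ t in c..l, (w t)⁻¹ :=
    intervalIntegral_pos_of_pos (hwi.intervalIntegrable _ _) (fun t => inv_pos.2 (hp t)) hcl
  refine ⟨u, ⟨_, huL⟩, by rw [hue, hul], hul, ⟨0, ⟨by linarith, by linarith⟩, ?_⟩, ?_, ?_⟩
  · rw [hu0 0 ⟨le_rfl, hc.le⟩]; exact hA.ne'
  · have e2 : ∫ t in (-l)..0, w t * deriv u t ^ 2 = ∫ t in (0:ℝ)..l, w t * deriv u t ^ 2 := by
      have := intervalIntegral.integral_comp_neg (a := 0) (b := l) (fun t => w t * deriv u t ^ 2)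
      have h3 : ∀ x, deriv u (-x) ^ 2 = deriv u x ^ 2 := fun x => by
        have h4 := deriv_comp_neg u x
        simp only [hue] at h4
        rw [h4]; ring
      simp only [he, h3, neg_zero] at this
      exact this.symm
    have e3 : ∫ t in (0:ℝ)..c, w t * deriv u t ^ 2 = 0 := by
      rw [intervalIntegral.integral_congr_ae (g := fun _ => (0:ℝ))]
      · simp
      filter_upwards [Measure.ae_ne volume c] with x hxc hx
      rw [Set.uIoc_of_le hc.le] at hx
      have : u =ᶠ[nhds x] fun _ => ∫ t in c..l, (w t)⁻¹ := by
        filter_upwards [Ioo_mem_nhds hx.1 (lt_of_le_of_ne hx.2 hxc)] with y hy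
        exact hu0 y ⟨hy.1.le, hy.2.le⟩
      rw [this.deriv_eq]; simp
    have e4 : ∫ t in c..l, w t * deriv u t ^ 2 = ∫ t in c..l, (w t)⁻¹ := by
      apply intervalIntegral.integral_congr_ae
      filter_upwards [Measure.ae_ne volume l] with x hxc hx
      rw [Set.uIoc_of_le hcl.le] at hx
      have : u =ᶠ[nhds x] F := by
        filter_upwards [Ioo_mem_nhds hx.1 (lt_of_le_of_ne hx.2 hxc)] with y hy
        simp only [hu, hκl y ⟨hy.1.le, hy.2.le⟩]
      rw [this.deriv_eq, (hFd x).deriv]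
      simp only [hg, hκl x ⟨hx.1.le, hx.2⟩]
      have := (hp x).ne'
      field_simp
    rw [← integral_add_adjacent_intervals (b := 0) (ii_deriv hw huL 2 _ _) (ii_deriv hw huL 2 _ _),
      e2, ← integral_add_adjacent_intervals (b := c) (ii_deriv hw huL 2 _ _) (ii_deriv hw huL 2 _ _),
      e3, e4]
    ring
  · have ii : ∀ a b, IntervalIntegrable (fun t => w t * u t ^ 2) volume a b := fun a b =>
      Continuous.intervalIntegrable (by fun_prop) _ _
    have e2 : ∫ t in (-l)..0, w t * u t ^ 2 = ∫ t in (0:ℝ)..l, w t * u t ^ 2 := by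
      have := intervalIntegral.integral_comp_neg (a := 0) (b := l) (fun t => w t * u t ^ 2)
      simp only [he, hue, neg_zero] at this
      exact this.symm
    have e3 : ∫ t in (0:ℝ)..c, w t * u t ^ 2 =
        (∫ t in (0:ℝ)..c, w t) * (∫ t in c..l, (w t)⁻¹) ^ 2 := by
      rw [← intervalIntegral.integral_mul_const]
      refine integral_congr fun t ht => ?_
      rw [Set.uIcc_of_le hc.le] at ht
      simp only [hu0 t ht]
    have e4 : 0 ≤ ∫ t in c..l, w t * u t ^ 2 :=
      integral_nonneg hcl.le fun t _ => mul_nonneg (hp t).le (sq_nonneg _)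
    rw [← integral_add_adjacent_intervals (b := 0) (ii _ _) (ii _ _), e2,
      ← integral_add_adjacent_intervals (b := c) (ii _ _) (ii _ _), e3]
    linarith

lemma laplaceA {l c : ℝ} (h0 : 0 ≤ c) (hcl : c < l) (hl : 2 < l ^ 2) :
    Filter.Tendsto (fun p : ℝ => p * Real.exp (-(p * (l ^ 2 - 1) ^ 2 / 4)) *
      ∫ t in c..l, (Real.exp (-p * ((t ^ 2 - 1) ^ 2 / 4)))⁻¹) Filter.atTop
      (nhds (l ^ 3 - l)⁻¹) := by
  have hl0 : 0 < l := h0.trans_lt hcl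
  have hb : 0 < l ^ 3 - l := by nlinarith
  have hκ : 0 < l * (l ^ 2 - 2) / 4 := by
    have : 0 < l ^ 2 - 2 := by linarith
    positivity
  set F : ℝ → ℝ → ℝ := fun p => Set.indicator (Set.Ioc 0 (p * (l - c)))
    (fun s => Real.exp (-(s * (2 * l - s / p) * (l ^ 2 + (l - s / p) ^ 2 - 2) / 4))) with hF
  have key : Filter.Tendsto (fun p => ∫ s, F p s) Filter.atTop
      (nhds (∫ s, Set.indicator (Set.Ioi 0) (fun s => Real.exp (-(l ^ 3 - l) * s)) s)) := by
    refine MeasureTheory.tendsto_integral_filter_of_dominated_convergence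
      (Set.indicator (Set.Ioi 0) (fun s => Real.exp (-(l * (l ^ 2 - 2) / 4) * s))) ?_ ?_ ?_ ?_
    · refine Filter.Eventually.of_forall fun p => ?_
      refine (Measurable.indicator ?_ measurableSet_Ioc).aestronglyMeasurable
      fun_prop
    · filter_upwards [Filter.eventually_gt_atTop 0] with p hp
      refine Filter.Eventually.of_forall fun s => ?_
      by_cases hs : s ∈ Set.Ioc 0 (p * (l - c))
      · have hs' : s ∈ Set.Ioi (0:ℝ) := hs.1
        simp only [hF, Set.indicator_of_mem hs, Set.indicator_of_mem hs']
        rw [Real.norm_eq_abs, Real.abs_exp, Real.exp_le_exp]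
        have h1 : s / p ≤ l - c := by rw [div_le_iff₀ hp]; linarith [hs.2]
        have h2 : l ≤ 2 * l - s / p := by linarith
        have h3 : l ^ 2 - 2 ≤ l ^ 2 + (l - s / p) ^ 2 - 2 := by nlinarith [sq_nonneg (l - s / p)]
        have h4 : l * (l ^ 2 - 2) ≤ (2 * l - s / p) * (l ^ 2 + (l - s / p) ^ 2 - 2) :=
          mul_le_mul h2 h3 (by linarith) (by linarith)
        have h5 := mul_le_mul_of_nonneg_left h4 hs.1.le
        linarith
      · simp only [hF, Set.indicator_of_notMem hs, norm_zero]
        exact Set.indicator_nonneg (fun _ _ => (Real.exp_pos _).le) _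
    · rw [integrable_indicator_iff measurableSet_Ioi]
      exact exp_neg_integrableOn_Ioi 0 hκ
    · refine Filter.Eventually.of_forall fun s => ?_
      by_cases hs : s ∈ Set.Ioi (0:ℝ)
      · rw [Set.indicator_of_mem hs]
        have ht : Filter.Tendsto (fun p : ℝ => s / p) Filter.atTop (nhds 0) :=
          Filter.Tendsto.const_div_atTop Filter.tendsto_id s
        have hcont : Continuous (fun y : ℝ =>
          Real.exp (-(s * (2 * l - y) * (l ^ 2 + (l - y) ^ 2 - 2) / 4))) := by fun_prop
        have := (hcont.tendsto 0).comp ht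
        have e : Real.exp (-(s * (2 * l - 0) * (l ^ 2 + (l - 0) ^ 2 - 2) / 4))
          = Real.exp (-(l ^ 3 - l) * s) := by congr 1; ring
        rw [e] at this
        refine this.congr' ?_
        filter_upwards [Filter.eventually_ge_atTop (s / (l - c))] with p hp
        rw [div_le_iff₀ (by linarith)] at hp
        simp only [hF]
        rw [Set.indicator_of_mem (Set.mem_Ioc.2 ⟨hs, hp⟩)]; rfl
      · rw [Set.indicator_of_notMem hs]
        refine tendsto_const_nhds.congr fun p => ?_
        simp only [hF]
        rw [Set.indicator_of_notMem fun h => hs h.1]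
  rw [MeasureTheory.integral_indicator measurableSet_Ioi, integral_exp_mul_Ioi (by linarith)] at key
  have e : -Real.exp (-(l ^ 3 - l) * 0) / -(l ^ 3 - l) = (l ^ 3 - l)⁻¹ := by
    simp only [mul_zero, Real.exp_zero, neg_div_neg_eq, one_div]
  rw [e] at key
  refine key.congr' ?_
  filter_upwards [Filter.eventually_gt_atTop 0] with p hp
  simp only [hF]
  rw [MeasureTheory.integral_indicator measurableSet_Ioc,
    ← intervalIntegral.integral_of_le (by have : 0 < l - c := by linarith
                                          positivity)]
  have := intervalIntegral.integral_comp_sub_div (a := 0) (b := p * (l - c))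
    (fun t => Real.exp (-(p * (l ^ 2 - 1) ^ 2 / 4)) * (Real.exp (-p * ((t ^ 2 - 1) ^ 2 / 4)))⁻¹)
    hp.ne' l
  have e1 : l - p * (l - c) / p = c := by field_simp; ring
  rw [e1, zero_div, sub_zero, smul_eq_mul] at this
  rw [mul_assoc, ← intervalIntegral.integral_const_mul, ← this]
  refine integral_congr fun s _ => ?_
  rw [← Real.exp_neg, ← Real.exp_add]
  congr 1
  field_simp
  ring

lemma laplaceB {c : ℝ} (hc : 1 < c) :
    Filter.Tendsto (fun p : ℝ => Real.sqrt p *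
      ∫ t in (0:ℝ)..c, Real.exp (-p * ((t ^ 2 - 1) ^ 2 / 4))) Filter.atTop
      (nhds (Real.sqrt Real.pi)) := by
  set F : ℝ → ℝ → ℝ := fun p => Set.indicator (Set.Ioc (-√p) (√p * (c - 1)))
    (fun s => Real.exp (-(s ^ 2 * (2 + s / √p) ^ 2 / 4))) with hF
  have key : Filter.Tendsto (fun p => ∫ s, F p s) Filter.atTop
      (nhds (∫ s : ℝ, Real.exp (-1 * s ^ 2))) := by
    refine MeasureTheory.tendsto_integral_filter_of_dominated_convergence
      (fun s => Real.exp (-(1 / 4) * s ^ 2)) ?_ ?_ ?_ ?_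
    · refine Filter.Eventually.of_forall fun p => ?_
      refine (Measurable.indicator ?_ measurableSet_Ioc).aestronglyMeasurable
      fun_prop
    · filter_upwards [Filter.eventually_gt_atTop 0] with p hp
      refine Filter.Eventually.of_forall fun s => ?_
      by_cases hs : s ∈ Set.Ioc (-√p) (√p * (c - 1))
      · simp only [hF, Set.indicator_of_mem hs]
        rw [Real.norm_eq_abs, Real.abs_exp, Real.exp_le_exp]
        have hq := Real.sqrt_pos.2 hp
        have h1 : -1 ≤ s / √p := by rw [le_div_iff₀ hq]; linarith [hs.1]
        have h2 : 1 ≤ (2 + s / √p) ^ 2 := by nlinarith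
        nlinarith [mul_le_mul_of_nonneg_left h2 (sq_nonneg s)]
      · simp only [hF, Set.indicator_of_notMem hs, norm_zero]
        exact (Real.exp_pos _).le
    · exact integrable_exp_neg_mul_sq (by norm_num)
    · refine Filter.Eventually.of_forall fun s => ?_
      have ht : Filter.Tendsto (fun p : ℝ => s / √p) Filter.atTop (nhds 0) :=
        Filter.Tendsto.const_div_atTop Real.tendsto_sqrt_atTop s
      have hcont : Continuous (fun y : ℝ =>
        Real.exp (-(s ^ 2 * (2 + y) ^ 2 / 4))) := by fun_prop
      have := (hcont.tendsto 0).comp ht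
      have e : Real.exp (-(s ^ 2 * (2 + 0) ^ 2 / 4))
        = Real.exp (-1 * s ^ 2) := by congr 1; ring
      rw [e] at this
      refine this.congr' ?_
      filter_upwards [Real.tendsto_sqrt_atTop.eventually_ge_atTop (s / (c - 1)),
        Real.tendsto_sqrt_atTop.eventually_gt_atTop (-s)] with p hp hp'
      rw [div_le_iff₀ (by linarith)] at hp
      simp only [hF]
      rw [Set.indicator_of_mem (Set.mem_Ioc.2 ⟨by linarith, hp⟩)]; rfl
  rw [integral_gaussian, div_one] at key
  refine key.congr' ?_
  filter_upwards [Filter.eventually_gt_atTop 0] with p hp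
  have hq := Real.sqrt_pos.2 hp
  have hqq := Real.sq_sqrt hp.le
  simp only [hF]
  rw [MeasureTheory.integral_indicator measurableSet_Ioc,
    ← intervalIntegral.integral_of_le (by nlinarith)]
  have := intervalIntegral.integral_comp_add_div (a := -√p) (b := √p * (c - 1))
    (fun t => Real.exp (-p * ((t ^ 2 - 1) ^ 2 / 4))) hq.ne' 1
  have e1 : 1 + √p * (c - 1) / √p = c := by field_simp; ring
  have e2 : 1 + -√p / √p = 0 := by field_simp; ring
  rw [e1, e2, smul_eq_mul] at this
  rw [← this]
  refine integral_congr fun s _ => ?_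
  congr 1
  have e3 : ((1 + s / √p) ^ 2 - 1) = s / √p * (2 + s / √p) := by ring
  rw [e3, mul_pow, div_pow, hqq]
  field_simp


lemma lam_bounds {l c : ℝ} (hc : 0 < c) (hcl : c < l) {b : ℝ → ℝ} (hb : Continuous b)
    (he : ∀ x, b (-x) = b x) (p : ℝ) :
    ((∫ t in (0:ℝ)..l, (Real.exp (-p * b t))⁻¹) * ∫ t in (0:ℝ)..l, Real.exp (-p * b t))⁻¹
      ≤ lam1d l b p ∧ lam1d l b p ≤
    ((∫ t in c..l, (Real.exp (-p * b t))⁻¹) * ∫ t in (0:ℝ)..c, Real.exp (-p * b t))⁻¹ := by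
  have hl : 0 < l := hc.trans hcl
  set w : ℝ → ℝ := fun x => Real.exp (-p * b x) with hw
  have hwc : Continuous w := by fun_prop
  have hwp : ∀ x, 0 < w x := fun x => Real.exp_pos _
  have hwe : ∀ x, w (-x) = w x := fun x => by simp [hw, he]
  have hwi : Continuous (fun t => (w t)⁻¹) := hwc.inv₀ fun t => (hwp t).ne'
  have pA : ∀ c < l, 0 < ∫ t in c..l, (w t)⁻¹ := fun c hcl =>
    intervalIntegral_pos_of_pos (hwi.intervalIntegrable _ _) (fun t => inv_pos.2 (hwp t)) hcl
  have pB : ∀ c > 0, 0 < ∫ t in (0:ℝ)..c, w t := fun c hcl =>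
    intervalIntegral_pos_of_pos (hwc.intervalIntegrable _ _) hwp hcl
  obtain ⟨u, hu1, hu2, hu3, hu4, hN, hD⟩ := test_fun hc hcl hwc hwp hwe
  unfold lam1d
  constructor
  · refine le_csInf ?_ ?_
    · exact ⟨_, u, hu1, hu2, hu3, hu4, rfl⟩
    rintro r ⟨v, ⟨K, hK⟩, hv2, hv3, ⟨x, hx, hvx⟩, rfl⟩
    have h := hardy_full hl hwc hwp hwe hK hv3 hv2
    have hvc := hK.continuous
    have hpos : 0 < ∫ t in (-l)..l, w t * v t ^ 2 := by
      refine intervalIntegral.integral_pos (by linarith) (by fun_prop)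
        (fun t _ => mul_nonneg (hwp t).le (sq_nonneg _)) ⟨x, hx, ?_⟩
      have := hwp x
      positivity
    rw [le_div_iff₀ hpos, inv_mul_le_iff₀ (mul_pos (pA 0 hl) (pB l hl))]
    linarith
  · refine (csInf_le (a := (∫ x in (-l)..l, w x * deriv u x ^ 2) / (∫ x in (-l)..l, w x * u x ^ 2))
      ⟨0, ?_⟩ ?_).trans ?_
    · rintro r ⟨v, -, -, -, -, rfl⟩
      refine div_nonneg ?_ ?_ <;>
      exact integral_nonneg (by linarith) fun t _ => mul_nonneg (hwp t).le (sq_nonneg _)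
    · exact ⟨u, hu1, hu2, hu3, hu4, rfl⟩
    · have h1 := pA c hcl
      have h2 := pB c hc
      have h3 : 0 < 2 * (∫ t in (0:ℝ)..c, w t) * (∫ t in c..l, (w t)⁻¹) ^ 2 := by positivity
      change (∫ x in (-l)..l, w x * deriv u x ^ 2) / (∫ x in (-l)..l, w x * u x ^ 2) ≤ _
      rw [hN]
      calc _ ≤ (2 * ∫ t in c..l, (w t)⁻¹) /
            (2 * (∫ t in (0:ℝ)..c, w t) * (∫ t in c..l, (w t)⁻¹) ^ 2) := by gcongr
        _ = ((∫ t in c..l, (w t)⁻¹) * ∫ t in (0:ℝ)..c, w t)⁻¹ := by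
          generalize (∫ t in c..l, (w t)⁻¹) = A at *
          generalize (∫ t in (0:ℝ)..c, w t) = B at *
          field_simp

lemma scale_eq {p A B E s m : ℝ} (hp : 0 < p) :
    (A * B)⁻¹ * (s / m) * p ^ (-(3 / 2) : ℝ) * Real.exp E
      = (s / m) * ((p * Real.exp (-E) * A) * (√p * B))⁻¹ := by
  have h : p ^ (-(3 / 2) : ℝ) = (p * √p)⁻¹ := by
    rw [Real.rpow_neg hp.le, Real.sqrt_eq_rpow]
    congr 1
    nth_rewrite 2 [← Real.rpow_one p]
    rw [← Real.rpow_add hp]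
    norm_num
  rw [h, Real.exp_neg]
  simp only [mul_inv, inv_inv]
  ring

theorem principal_eigenvalue_asymptotics_double_well (l : ℝ) (hl : Real.sqrt 2 < l) :
    Filter.Tendsto
      (fun p : ℝ => lam1d l (fun x => (x ^ 2 - 1) ^ 2 / 4) p *
        (Real.sqrt Real.pi / (l ^ 3 - l)) * p ^ (-(3 / 2) : ℝ) *
        Real.exp (p * (l ^ 2 - 1) ^ 2 / 4))
      Filter.atTop (nhds 1) := by
  have h2 : 2 < l ^ 2 := by
    have h0 := Real.sqrt_nonneg 2
    have := Real.sq_sqrt (show (0:ℝ) ≤ 2 by norm_num)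
    nlinarith
  have hl1 : 1 < l := lt_trans (by rw [Real.lt_sqrt] <;> norm_num) hl
  have hm : 0 < l ^ 3 - l := by nlinarith
  have hpi : 0 < √Real.pi := Real.sqrt_pos.2 Real.pi_pos
  have hlim : ∀ a c : ℝ, 0 ≤ a → a < l → 1 < c →
      Filter.Tendsto (fun p : ℝ =>
        ((∫ t in a..l, (Real.exp (-p * ((t ^ 2 - 1) ^ 2 / 4)))⁻¹) *
          ∫ t in (0:ℝ)..c, Real.exp (-p * ((t ^ 2 - 1) ^ 2 / 4)))⁻¹ *
        (Real.sqrt Real.pi / (l ^ 3 - l)) * p ^ (-(3 / 2) : ℝ) *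
        Real.exp (p * (l ^ 2 - 1) ^ 2 / 4)) Filter.atTop (nhds 1) := by
    intro a c ha hal hc
    have h := ((laplaceA ha hal h2).mul (laplaceB hc)).inv₀ (by positivity)
    have h' := h.const_mul (√Real.pi / (l ^ 3 - l))
    have e : √Real.pi / (l ^ 3 - l) * ((l ^ 3 - l)⁻¹ * √Real.pi)⁻¹ = 1 := by
      have hm' := hm.ne'
      generalize l ^ 3 - l = m at hm'
      field_simp
    rw [e] at h'
    refine h'.congr' ?_
    filter_upwards [Filter.eventually_gt_atTop 0] with p hp
    rw [scale_eq hp]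
  have hc1 : 1 < (1 + l) / 2 := by linarith
  have hc2 : (1 + l) / 2 < l := by linarith
  have hb := fun p => lam_bounds (l := l) (c := (1 + l) / 2) (by linarith) hc2
    (b := fun x => (x ^ 2 - 1) ^ 2 / 4) (by fun_prop) (fun x => by simp) p
  refine tendsto_of_tendsto_of_tendsto_of_le_of_le' (hlim 0 l le_rfl (by linarith) hl1)
    (hlim _ _ (by linarith) hc2 hc1) ?_ ?_
  all_goals
    filter_upwards [Filter.eventually_gt_atTop 0] with p hp
    have h0 : 0 ≤ √Real.pi / (l ^ 3 - l) := by positivity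
    have h1 : 0 ≤ p ^ (-(3 / 2) : ℝ) := Real.rpow_nonneg hp.le _
    have h3 := (Real.exp_pos (p * (l ^ 2 - 1) ^ 2 / 4)).le
    refine mul_le_mul_of_nonneg_right (mul_le_mul_of_nonneg_right
      (mul_le_mul_of_nonneg_right ?_ h0) h1) h3
  · exact (hb p).1
  · exact (hb p).2
end
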